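/- arXiv:2109.08797 — 2 statements merged into one kernel-verified Lean document; each statement's English description precedes it below -/
import Mathlib

section
/- Let ψ : ℝ³ → ℝ be infinitely differentiable and let F : ℝ → ℝ be continuously differentiable with F'(s) > −2 for every s ∈ ℝ. If the spherical-coordinate representation Ψ of ψ satisfies (ΔΨ)(φ,θ) = F(Ψ(φ,θ)) for all φ ∈ ℝ and θ ∈ (−π/2, π/2), then ψ is constant on the unit sphere S². -/
open Real MeasureTheory

noncomputable section

/-- The point of the unit sphere with longitude `φ` and latitude `θ`. -/
def sphPt (φ θ : ℝ) : ℝ × ℝ × ℝ :=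
  (Real.cos φ * Real.cos θ, Real.sin φ * Real.cos θ, Real.sin θ)

/-- The spherical-coordinate representation of a function `ψ : ℝ³ → ℝ`. -/
def sphRep (ψ : ℝ × ℝ × ℝ → ℝ) (φ θ : ℝ) : ℝ := ψ (sphPt φ θ)

/-- The Laplace–Beltrami operator of the unit sphere in longitude-latitude coordinates:
`(ΔΨ)(φ,θ) = ∂θ²Ψ − tan θ · ∂θΨ + (1/cos²θ) · ∂φ²Ψ`. -/
def LB (Ψ : ℝ → ℝ → ℝ) (φ θ : ℝ) : ℝ :=
  iteratedDeriv 2 (fun θ' => Ψ φ θ') θ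
    - Real.tan θ * deriv (fun θ' => Ψ φ θ') θ
    + (1 / Real.cos θ ^ 2) * iteratedDeriv 2 (fun φ' => Ψ φ' θ) φ

section PartialDerivatives

/-- The partial derivative of a function on the plane in its first variable. -/
def partialFst (f : ℝ × ℝ → ℝ) (p : ℝ × ℝ) : ℝ := fderiv ℝ f p (1, 0)

/-- The partial derivative of a function on the plane in its second variable. -/
def partialSnd (f : ℝ × ℝ → ℝ) (p : ℝ × ℝ) : ℝ := fderiv ℝ f p (0, 1)

variable {f : ℝ × ℝ → ℝ}

lemma ContDiff.partialFst (hf : ContDiff ℝ (⊤ : ℕ∞) f) :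
    ContDiff ℝ (⊤ : ℕ∞) (partialFst f) :=
  (hf.fderiv_right (m := (⊤ : ℕ∞)) (by simp)).clm_apply contDiff_const

lemma ContDiff.partialSnd (hf : ContDiff ℝ (⊤ : ℕ∞) f) :
    ContDiff ℝ (⊤ : ℕ∞) (partialSnd f) :=
  (hf.fderiv_right (m := (⊤ : ℕ∞)) (by simp)).clm_apply contDiff_const

lemma hasDerivAt_partialFst (hf : ContDiff ℝ (⊤ : ℕ∞) f) (φ θ : ℝ) :
    HasDerivAt (fun t => f (t, θ)) (partialFst f (φ, θ)) φ := by
  have h := (hf.differentiable (by simp) (φ, θ)).hasFDerivAt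
  exact h.comp_hasDerivAt φ ((hasDerivAt_id φ).prodMk (hasDerivAt_const φ θ))

lemma hasDerivAt_partialSnd (hf : ContDiff ℝ (⊤ : ℕ∞) f) (φ θ : ℝ) :
    HasDerivAt (fun t => f (φ, t)) (partialSnd f (φ, θ)) θ := by
  have h := (hf.differentiable (by simp) (φ, θ)).hasFDerivAt
  exact h.comp_hasDerivAt θ ((hasDerivAt_const θ φ).prodMk (hasDerivAt_id θ))

lemma partialFst_partialSnd (hf : ContDiff ℝ (⊤ : ℕ∞) f) (p : ℝ × ℝ) :
    partialFst (partialSnd f) p = partialSnd (partialFst f) p := by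
  have hd : DifferentiableAt ℝ (fderiv ℝ f) p :=
    (hf.fderiv_right (m := (⊤ : ℕ∞)) (by simp)).differentiable (by simp) p
  have hs : IsSymmSndFDerivAt ℝ f p :=
    hf.contDiffAt.isSymmSndFDerivAt (by
      simp only [minSmoothness_of_isRCLikeNormedField]
      exact WithTop.coe_le_coe.2 le_top)
  change fderiv ℝ (fun q => fderiv ℝ f q (0, 1)) p (1, 0)
    = fderiv ℝ (fun q => fderiv ℝ f q (1, 0)) p (0, 1)
  rw [fderiv_clm_apply hd (by fun_prop), fderiv_clm_apply hd (by fun_prop)]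
  simpa using hs.eq (1, 0) (0, 1)

lemma fderiv_add_fst {a : ℝ} (hper : ∀ φ θ, f (φ + a, θ) = f (φ, θ)) (φ θ : ℝ) :
    fderiv ℝ f (φ + a, θ) = fderiv ℝ f (φ, θ) := by
  have h := fderiv_comp_add_right (𝕜 := ℝ) (f := f) (x := (φ, θ)) (a, 0)
  have hf : (fun x => f (x + (a, 0))) = f := by
    ext ⟨x, y⟩
    simpa using hper x y
  rw [hf] at h
  simpa using h.symm

lemma partialFst_add_fst {a : ℝ} (hper : ∀ φ θ, f (φ + a, θ) = f (φ, θ)) (φ θ : ℝ) :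
    partialFst f (φ + a, θ) = partialFst f (φ, θ) := by
  simp only [partialFst, fderiv_add_fst hper]

lemma partialSnd_add_fst {a : ℝ} (hper : ∀ φ θ, f (φ + a, θ) = f (φ, θ)) (φ θ : ℝ) :
    partialSnd f (φ + a, θ) = partialSnd f (φ, θ) := by
  simp only [partialSnd, fderiv_add_fst hper]

end PartialDerivatives

lemma integral_integral_swap_of_continuous {K : ℝ × ℝ → ℝ} (hK : Continuous K)
    {a b c d : ℝ} (hab : a ≤ b) (hcd : c ≤ d) :
    ∫ y in c..d, ∫ x in a..b, K (x, y) = ∫ x in a..b, ∫ y in c..d, K (x, y) := by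
  simp only [intervalIntegral.integral_of_le hab, intervalIntegral.integral_of_le hcd]
  refine (integral_integral_swap (f := fun x y => K (x, y)) ?_).symm
  rw [Measure.prod_restrict]
  change IntegrableOn K _ _
  exact (hK.continuousOn.integrableOn_compact (isCompact_Icc.prod isCompact_Icc)).mono_set
    (Set.prod_mono Set.Ioc_subset_Icc_self Set.Ioc_subset_Icc_self)

/-- If `K = ∂θ W` where the flux `W` vanishes at the poles, and the averages of `K` over the
circles of latitude are nonnegative, then these averages vanish. -/
lemma average_eq_zero_of_divergence {K W : ℝ × ℝ → ℝ} {a : ℝ} (hK : Continuous K)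
    (hW : ∀ φ θ, HasDerivAt (fun t => W (φ, t)) (K (φ, θ)) θ)
    (hW₁ : ∀ φ, W (φ, -(π / 2)) = 0) (hW₂ : ∀ φ, W (φ, π / 2) = 0)
    (hpos : ∀ θ ∈ Set.Ioo (-(π / 2)) (π / 2), 0 ≤ ∫ φ in a..a + 2 * π, K (φ, θ)) :
    ∀ θ ∈ Set.Ioo (-(π / 2)) (π / 2), ∫ φ in a..a + 2 * π, K (φ, θ) = 0 := by
  have hpi := pi_pos
  set k : ℝ → ℝ := fun θ => ∫ φ in a..a + 2 * π, K (φ, θ) with hk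
  have hkc : Continuous k :=
    intervalIntegral.continuous_parametric_intervalIntegral_of_continuous'
      (f := fun θ φ => K (φ, θ)) (by unfold Function.uncurry; fun_prop) a (a + 2 * π)
  have hkpos : ∀ θ ∈ Set.Icc (-(π / 2)) (π / 2), 0 ≤ k θ := by
    have hcl : IsClosed {θ | 0 ≤ k θ} := isClosed_le continuous_const hkc
    have := closure_minimal (s := Set.Ioo (-(π / 2)) (π / 2)) (fun θ hθ => hpos θ hθ) hcl
    rwa [closure_Ioo (by linarith)] at this
  have hzero : ∫ θ in -(π / 2)..π / 2, k θ = 0 := by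
    rw [hk, integral_integral_swap_of_continuous hK (by linarith) (by linarith)]
    have : ∀ φ, ∫ θ in -(π / 2)..π / 2, K (φ, θ) = 0 := fun φ => by
      rw [intervalIntegral.integral_eq_sub_of_hasDerivAt (fun θ _ => hW φ θ)
        ((by fun_prop : Continuous fun θ => K (φ, θ)).intervalIntegrable _ _), hW₁, hW₂, sub_zero]
    simp [this]
  intro θ hθ
  by_contra hne
  have hlt : 0 < k θ := lt_of_le_of_ne (hpos θ hθ) (Ne.symm hne)
  have := intervalIntegral.integral_pos (by linarith : -(π / 2) < π / 2) hkc.continuousOn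
    (fun x hx => hkpos x (Set.Ioc_subset_Icc_self hx)) ⟨θ, Set.Ioo_subset_Icc_self hθ, hlt⟩
  exact this.ne' hzero

/-- The Bochner identity for `|∇Ψ|² - Φ(Ψ)`, `Φ' = F`, in longitude-latitude coordinates: `c` and
`s` stand for `cos θ` and `sin θ`, `A` and `B` for the components of the gradient, and numerical
subscripts for derivatives in longitude (`1`) and latitude (`2`). -/
lemma bochner_identity {c s f f' A B A₁ A₂ B₁ B₂ A₁₁ A₁₂ A₂₂ B₁₁ B₁₂ B₂₂ : ℝ}
    (h₁ : A₁ = -s * B + c * B₂)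
    (h₁₁ : A₁₁ = -s * B₁ + c * B₁₂)
    (h₁₂ : A₁₂ = -c * B + -s * B₂ + (-s * B₂ + c * B₂₂))
    (hL : c * A₂ - s * A + B₁ = c * f)
    (hL₁ : c * A₁₂ - s * A₁ + B₁₁ = c * (f' * (c * B)))
    (hL₂ : (-s * A₂ + c * A₂₂) - (c * A + s * A₂) + B₁₂ = -s * f + c * (f' * A)) :
    c * (-s * (2 * A * A₂ + 2 * B * B₂ - f * A)
        + c * (2 * A₂ ^ 2 + 2 * A * A₂₂ + 2 * B₂ ^ 2 + 2 * B * B₂₂ - (f' * A * A + f * A₂)))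
      + (2 * A₁ ^ 2 + 2 * A * A₁₁ + 2 * B₁ ^ 2 + 2 * B * B₁₁
        - c * (f' * (c * B) * B + f * B₁))
    = (c * A₂ - B₁ + s * A) ^ 2 + 4 * (c * B₂) ^ 2 + c ^ 2 * ((f' + 2) * (A ^ 2 + B ^ 2)) := by
  have e₁ : B₁ = c * f - c * A₂ + s * A := by linarith
  have e₁₂ : B₁₂ = -s * f + c * (f' * A) - ((-s * A₂ + c * A₂₂) - (c * A + s * A₂)) := by linarith
  have e₁₁ : B₁₁ = c * (f' * (c * B)) - c * A₁₂ + s * A₁ := by linarith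
  subst e₁₁ h₁₁ e₁₂ h₁₂ h₁ e₁
  ring

section Plane

variable {Ψ B : ℝ × ℝ → ℝ} {F : ℝ → ℝ}

lemma partialSnd_eq_zero_of_semilinear (hΨ : ContDiff ℝ (⊤ : ℕ∞) Ψ) (hB : ContDiff ℝ (⊤ : ℕ∞) B)
    (hΨper : ∀ φ θ, Ψ (φ + 2 * π, θ) = Ψ (φ, θ)) (hBper : ∀ φ θ, B (φ + 2 * π, θ) = B (φ, θ))
    (hΨB : ∀ φ θ, partialFst Ψ (φ, θ) = cos θ * B (φ, θ))
    (hF : ContDiff ℝ 1 F) (hF' : ∀ s : ℝ, deriv F s > -2)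
    (heq : ∀ φ θ : ℝ, θ ∈ Set.Ioo (-(π / 2)) (π / 2) →
      cos θ * partialSnd (partialSnd Ψ) (φ, θ) - sin θ * partialSnd Ψ (φ, θ)
        + partialFst B (φ, θ) = cos θ * F (Ψ (φ, θ)))
    {φ θ : ℝ} (hθ : θ ∈ Set.Ioo (-(π / 2)) (π / 2)) : partialSnd Ψ (φ, θ) = 0 := by
  have hA := hΨ.partialSnd
  have hAΨ := hasDerivAt_partialSnd hΨ
  have hBΨ := hasDerivAt_partialFst hΨ
  simp only [hΨB] at hBΨ
  have hmixed := fun φ θ => partialFst_partialSnd hΨ (φ, θ)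
  have hAper := partialSnd_add_fst hΨper
  generalize partialSnd Ψ = A at *
  have hA₁ := hasDerivAt_partialFst hA
  have hA₂ := hasDerivAt_partialSnd hA
  have hB₁ := hasDerivAt_partialFst hB
  have hB₂ := hasDerivAt_partialSnd hB
  have hA₁₁ := hasDerivAt_partialFst hA.partialFst
  have hA₁₂ := hasDerivAt_partialSnd hA.partialFst
  have hA₂₁ := hasDerivAt_partialFst hA.partialSnd
  have hA₂₂ := hasDerivAt_partialSnd hA.partialSnd
  have hB₁₁ := hasDerivAt_partialFst hB.partialFst
  have hB₁₂ := hasDerivAt_partialSnd hB.partialFst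
  have hB₂₁ := hasDerivAt_partialFst hB.partialSnd
  have hB₂₂ := hasDerivAt_partialSnd hB.partialSnd
  simp only [partialFst_partialSnd hA] at hA₂₁
  simp only [partialFst_partialSnd hB] at hB₂₁
  have hFd : ∀ s, HasDerivAt F (deriv F s) s := fun s =>
    (hF.differentiable (by simp) s).hasDerivAt
  have hFΨ₁ := fun φ θ => (hFd (Ψ (φ, θ))).comp φ (hBΨ φ θ)
  have hFΨ₂ := fun φ θ => (hFd (Ψ (φ, θ))).comp θ (hAΨ φ θ)
  simp only [Function.comp_def] at hFΨ₁ hFΨ₂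
  have h₁ : ∀ φ θ, partialFst A (φ, θ) = -sin θ * B (φ, θ) + cos θ * partialSnd B (φ, θ) := by
    intro φ θ
    rw [hmixed]
    have h := hasDerivAt_partialSnd hΨ.partialFst φ θ
    simp only [hΨB] at h
    exact h.unique ((hasDerivAt_cos θ).mul (hB₂ φ θ))
  have h₁₁ := fun φ θ => (hA₁₁ φ θ).unique
    ((((hB₁ φ θ).const_mul (-sin θ)).add ((hB₂₁ φ θ).const_mul (cos θ))).congr_of_eventuallyEq
      (.of_forall fun t => h₁ t θ))
  have h₁₂ := fun φ θ => (hA₁₂ φ θ).unique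
    ((((hasDerivAt_sin θ).neg.mul (hB₂ φ θ)).add
      ((hasDerivAt_cos θ).mul (hB₂₂ φ θ))).congr_of_eventuallyEq
      (.of_forall fun t => h₁ φ t))
  have hL₁ := fun φ θ hθ =>
    ((((hA₂₁ φ θ).const_mul (cos θ)).sub ((hA₁ φ θ).const_mul (sin θ))).add (hB₁₁ φ θ)).unique
      (((hFΨ₁ φ θ).const_mul (cos θ)).congr_of_eventuallyEq (.of_forall fun t => heq t θ hθ))
  have hL₂ := fun φ θ (hθ : θ ∈ Set.Ioo (-(π / 2)) (π / 2)) =>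
    ((((hasDerivAt_cos θ).mul (hA₂₂ φ θ)).sub ((hasDerivAt_sin θ).mul (hA₂ φ θ))).add
      (hB₁₂ φ θ)).unique
      (((hasDerivAt_cos θ).mul (hFΨ₂ φ θ)).congr_of_eventuallyEq
        (Filter.eventually_of_mem (isOpen_Ioo.mem_nhds hθ) fun t ht => heq φ t ht))
  have hFc := hF.continuous
  have hF'c : Continuous (deriv F) := hF.continuous_deriv le_rfl
  have cΨ := hΨ.continuous
  have cA := hA.continuous
  have cB := hB.continuous
  have cA₁ := hA.partialFst.continuous
  have cA₂ := hA.partialSnd.continuous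
  have cB₁ := hB.partialFst.continuous
  have cB₂ := hB.partialSnd.continuous
  have cA₁₁ := hA.partialFst.partialFst.continuous
  have cA₂₂ := hA.partialSnd.partialSnd.continuous
  have cB₁₁ := hB.partialFst.partialFst.continuous
  have cB₂₂ := hB.partialSnd.partialSnd.continuous
  let W : ℝ × ℝ → ℝ := fun p => cos p.2 *
    (2 * A p * partialSnd A p + 2 * B p * partialSnd B p - F (Ψ p) * A p)
  let K : ℝ × ℝ → ℝ := fun p =>
    -sin p.2 * (2 * A p * partialSnd A p + 2 * B p * partialSnd B p - F (Ψ p) * A p)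
      + cos p.2 * (2 * partialSnd A p ^ 2 + 2 * A p * partialSnd (partialSnd A) p
        + 2 * partialSnd B p ^ 2 + 2 * B p * partialSnd (partialSnd B) p
        - (deriv F (Ψ p) * A p * A p + F (Ψ p) * partialSnd A p))
  let V : ℝ × ℝ → ℝ := fun p =>
    2 * A p * partialFst A p + 2 * B p * partialFst B p - cos p.2 * (F (Ψ p) * B p)
  let V₁ : ℝ × ℝ → ℝ := fun p =>
    2 * partialFst A p ^ 2 + 2 * A p * partialFst (partialFst A) p + 2 * partialFst B p ^ 2
      + 2 * B p * partialFst (partialFst B) p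
      - cos p.2 * (deriv F (Ψ p) * (cos p.2 * B p) * B p + F (Ψ p) * partialFst B p)
  let N : ℝ × ℝ → ℝ := fun p =>
    (cos p.2 * partialSnd A p - partialFst B p + sin p.2 * A p) ^ 2
      + 4 * (cos p.2 * partialSnd B p) ^ 2
      + cos p.2 ^ 2 * ((deriv F (Ψ p) + 2) * (A p ^ 2 + B p ^ 2))
  have hKc : Continuous K := by fun_prop
  have hV₁c : Continuous V₁ := by fun_prop
  have hNc : Continuous N := by fun_prop
  have hW : ∀ φ θ, HasDerivAt (fun t => W (φ, t)) (K (φ, θ)) θ := fun φ θ => by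
    refine ((hasDerivAt_cos θ).mul (((((hA₂ φ θ).const_mul 2).mul (hA₂₂ φ θ)).add
      (((hB₂ φ θ).const_mul 2).mul (hB₂₂ φ θ))).sub ((hFΨ₂ φ θ).mul (hA₂ φ θ)))).congr_deriv ?_
    simp only [K, Pi.add_apply, Pi.sub_apply, Pi.mul_apply]
    ring
  have hV : ∀ φ θ, HasDerivAt (fun t => V (t, θ)) (V₁ (φ, θ)) φ := fun φ θ => by
    refine (((((hA₁ φ θ).const_mul 2).mul (hA₁₁ φ θ)).add
      (((hB₁ φ θ).const_mul 2).mul (hB₁₁ φ θ))).sub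
      (((hFΨ₁ φ θ).mul (hB₁ φ θ)).const_mul (cos θ))).congr_deriv ?_
    simp only [V₁]
    ring
  have hVint : ∀ a θ, ∫ φ in a..a + 2 * π, V₁ (φ, θ) = 0 := fun a θ => by
    rw [intervalIntegral.integral_eq_sub_of_hasDerivAt (fun φ _ => hV φ θ)
      ((by fun_prop : Continuous fun φ => V₁ (φ, θ)).intervalIntegrable _ _)]
    simp only [V, hΨper, hAper, hBper, partialFst_add_fst hAper, partialFst_add_fst hBper, sub_self]
  have hKVN : ∀ φ θ, θ ∈ Set.Ioo (-(π / 2)) (π / 2) →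
      cos θ * K (φ, θ) + V₁ (φ, θ) = N (φ, θ) := fun φ θ hθ =>
    bochner_identity (h₁ φ θ) (h₁₁ φ θ) (h₁₂ φ θ) (heq φ θ hθ) (hL₁ φ θ hθ) (hL₂ φ θ hθ)
  have hKN : ∀ a θ, θ ∈ Set.Ioo (-(π / 2)) (π / 2) →
      cos θ * ∫ φ in a..a + 2 * π, K (φ, θ) = ∫ φ in a..a + 2 * π, N (φ, θ) := fun a θ hθ => by
    simp only [← hKVN _ θ hθ]
    rw [intervalIntegral.integral_add
      ((by fun_prop : Continuous fun φ => cos θ * K (φ, θ)).intervalIntegrable _ _)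
      ((by fun_prop : Continuous fun φ => V₁ (φ, θ)).intervalIntegrable _ _), hVint, add_zero,
      intervalIntegral.integral_const_mul]
  have hNpos : ∀ p, 0 ≤ N p := fun p => by
    have : 0 < deriv F (Ψ p) + 2 := by linarith [hF' (Ψ p)]
    positivity
  have hpi := pi_pos
  have hKzero := average_eq_zero_of_divergence (a := φ) hKc hW (by simp [W]) (by simp [W])
    (fun θ hθ => nonneg_of_mul_nonneg_right
      ((hKN φ θ hθ).symm ▸ intervalIntegral.integral_nonneg (by linarith) fun _ _ => hNpos _)
      (cos_pos_of_mem_Ioo hθ)) θ hθ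
  have hNzero : ∫ t in φ..φ + 2 * π, N (t, θ) = 0 := by rw [← hKN φ θ hθ, hKzero, mul_zero]
  by_contra hne
  refine (intervalIntegral.integral_pos (by linarith : φ < φ + 2 * π)
    (by fun_prop : Continuous fun t => N (t, θ)).continuousOn (fun t _ => hNpos _)
    ⟨φ, ⟨le_rfl, by linarith⟩, ?_⟩).ne' hNzero
  have hF2 : 0 < deriv F (Ψ (φ, θ)) + 2 := by linarith [hF' (Ψ (φ, θ))]
  have hc : 0 < cos θ := cos_pos_of_mem_Ioo hθ
  have hA2 : 0 < A (φ, θ) ^ 2 := by positivity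
  simp only [N]
  positivity

end Plane

lemma contDiff_sphPt : ContDiff ℝ (⊤ : ℕ∞) (fun p : ℝ × ℝ => sphPt p.1 p.2) := by
  unfold sphPt
  fun_prop

lemma sphPt_add_two_pi (φ θ : ℝ) : sphPt (φ + 2 * π) θ = sphPt φ θ := by
  simp [sphPt]

lemma exists_sphPt_eq {x : ℝ × ℝ × ℝ} (hx : x.1 ^ 2 + x.2.1 ^ 2 + x.2.2 ^ 2 = 1) :
    ∃ φ, ∃ θ ∈ Set.Icc (-(π / 2)) (π / 2), sphPt φ θ = x := by
  obtain ⟨x, y, z⟩ := x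
  simp only at hx
  refine ⟨Complex.arg ⟨x, y⟩, arcsin z, arcsin_mem_Icc z, ?_⟩
  have hcos : cos (arcsin z) = ‖(⟨x, y⟩ : ℂ)‖ := by
    rw [cos_arcsin, Complex.norm_eq_sqrt_sq_add_sq]
    congr 1
    simp only
    linarith
  have hsin : sin (arcsin z) = z := sin_arcsin (by nlinarith) (by nlinarith)
  simp only [sphPt, hcos, hsin]
  rw [mul_comm, Complex.norm_mul_cos_arg, mul_comm, Complex.norm_mul_sin_arg]

/-- The longitude derivative of a function on the sphere is `cos θ` times its derivative in the
direction of the unit tangent vector `(-sin φ, cos φ, 0)`. -/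
lemma hasDerivAt_sphRep_longitude {ψ : ℝ × ℝ × ℝ → ℝ} (hψ : ContDiff ℝ (⊤ : ℕ∞) ψ) (φ θ : ℝ) :
    HasDerivAt (fun t => sphRep ψ t θ)
      (cos θ * fderiv ℝ ψ (sphPt φ θ) (-sin φ, cos φ, 0)) φ := by
  have h := (hψ.differentiable (by simp) (sphPt φ θ)).hasFDerivAt
  have hs : HasDerivAt (fun t => sphPt t θ) (cos θ • (-sin φ, cos φ, (0 : ℝ))) φ := by
    have h1 := (((hasDerivAt_cos φ).mul_const (cos θ)).prodMk
      (((hasDerivAt_sin φ).mul_const (cos θ)).prodMk (hasDerivAt_const φ (sin θ))))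
    exact h1.congr_deriv (by simp [mul_comm])
  have := h.comp_hasDerivAt φ hs
  rwa [map_smul, smul_eq_mul] at this

lemma deriv_sphRep_latitude_eq_zero {ψ : ℝ × ℝ × ℝ → ℝ} {F : ℝ → ℝ}
    (hψ : ContDiff ℝ (⊤ : ℕ∞) ψ) (hF : ContDiff ℝ 1 F) (hF' : ∀ s : ℝ, deriv F s > -2)
    (heq : ∀ φ θ : ℝ, θ ∈ Set.Ioo (-(π / 2)) (π / 2) →
      LB (sphRep ψ) φ θ = F (sphRep ψ φ θ))
    {φ θ : ℝ} (hθ : θ ∈ Set.Ioo (-(π / 2)) (π / 2)) :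
    deriv (fun t => sphRep ψ φ t) θ = 0 := by
  let Ψ : ℝ × ℝ → ℝ := fun p => sphRep ψ p.1 p.2
  let B : ℝ × ℝ → ℝ := fun p => fderiv ℝ ψ (sphPt p.1 p.2) (-sin p.1, cos p.1, 0)
  have hΨ : ContDiff ℝ (⊤ : ℕ∞) Ψ := hψ.comp contDiff_sphPt
  have hB : ContDiff ℝ (⊤ : ℕ∞) B :=
    ((hψ.fderiv_right (m := (⊤ : ℕ∞)) (by simp)).comp contDiff_sphPt).clm_apply (by fun_prop)
  have hd₂ : ∀ φ, deriv (fun t => sphRep ψ φ t) = fun θ => partialSnd Ψ (φ, θ) := fun φ =>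
    funext fun θ => (hasDerivAt_partialSnd hΨ φ θ).deriv
  have hd₁ : ∀ θ, deriv (fun t => sphRep ψ t θ) = fun φ => cos θ * B (φ, θ) := fun θ =>
    funext fun φ => (hasDerivAt_sphRep_longitude hψ φ θ).deriv
  rw [hd₂]
  refine partialSnd_eq_zero_of_semilinear hΨ hB ?_ ?_ ?_ hF hF' ?_ hθ
  · intro φ θ
    simp only [Ψ, sphRep, sphPt_add_two_pi]
  · intro φ θ
    simp only [B, sphPt_add_two_pi, sin_add_two_pi, cos_add_two_pi]
  · exact fun φ θ => (hasDerivAt_partialFst hΨ φ θ).unique (hasDerivAt_sphRep_longitude hψ φ θ)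
  · intro φ θ hθ
    have hc : cos θ ≠ 0 := (cos_pos_of_mem_Ioo hθ).ne'
    have h := heq φ θ hθ
    rw [LB, iteratedDeriv_succ, iteratedDeriv_one, iteratedDeriv_succ, iteratedDeriv_one, hd₂, hd₁,
      (hasDerivAt_partialSnd hΨ.partialSnd φ θ).deriv,
      ((hasDerivAt_partialFst hB φ θ).const_mul (cos θ)).deriv, tan_eq_sin_div_cos] at h
    change _ = cos θ * F (sphRep ψ φ θ)
    rw [← h]
    field_simp

/-- If `F' > −2` everywhere and the spherical representation of the smooth function `ψ`
satisfies `ΔΨ = F(Ψ)`, then `ψ` is constant on the unit sphere. -/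
theorem rigidity_constant (ψ : ℝ × ℝ × ℝ → ℝ) (F : ℝ → ℝ)
    (hψ : ContDiff ℝ (⊤ : ℕ∞) ψ) (hF : ContDiff ℝ 1 F)
    (hF' : ∀ s : ℝ, deriv F s > -2)
    (heq : ∀ φ θ : ℝ, θ ∈ Set.Ioo (-(π/2)) (π/2) →
      LB (sphRep ψ) φ θ = F (sphRep ψ φ θ)) :
    ∀ x y : ℝ × ℝ × ℝ,
      x.1 ^ 2 + x.2.1 ^ 2 + x.2.2 ^ 2 = 1 → y.1 ^ 2 + y.2.1 ^ 2 + y.2.2 ^ 2 = 1 →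
      ψ x = ψ y := by
  have hpole : ∀ φ, ∀ θ ∈ Set.Icc (-(π / 2)) (π / 2), sphRep ψ φ θ = ψ (0, 0, -1) := by
    intro φ θ hθ
    have hdiff : Differentiable ℝ (fun t => sphRep ψ φ t) :=
      (hψ.comp (contDiff_sphPt.comp (contDiff_prodMk_right φ))).differentiable (by simp)
    rcases hθ.1.eq_or_lt with rfl | hlt
    · simp [sphRep, sphPt]
    · obtain ⟨t, ht, hslope⟩ := exists_deriv_eq_slope (fun t => sphRep ψ φ t) hlt
        hdiff.continuous.continuousOn hdiff.differentiableOn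
      rw [deriv_sphRep_latitude_eq_zero hψ hF hF' heq ⟨ht.1, ht.2.trans_le hθ.2⟩, eq_comm,
        div_eq_zero_iff, or_iff_left (sub_pos.2 hlt).ne', sub_eq_zero] at hslope
      rw [hslope]
      simp [sphRep, sphPt]
  intro x y hx hy
  obtain ⟨φ, θ, hθ, rfl⟩ := exists_sphPt_eq hx
  obtain ⟨φ', θ', hθ', rfl⟩ := exists_sphPt_eq hy
  exact (hpole φ θ hθ).trans (hpole φ' θ' hθ').symm
end
end

section
/- Let ψ : ℝ³ → ℝ be infinitely differentiable and let F : ℝ → ℝ be continuously differentiable with F'(s) > −6 for every s ∈ ℝ. If the spherical-coordinate representation Ψ of ψ satisfies (ΔΨ)(φ,θ) = F(Ψ(φ,θ)) for all φ ∈ ℝ and θ ∈ (−π/2, π/2), then ψ is zonal up to a rotation: there exist a unit vector v ∈ ℝ³ and a function g : ℝ → ℝ such that ψ(x) = g(⟨x, v⟩) for every x in the unit sphere S². -/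
open Real MeasureTheory

noncomputable section

/-- Wirtinger's inequality on the circle, for mean-zero functions, with the contribution of the
first Fourier mode made explicit. -/
theorem wirtinger_second_mode {f f' : ℝ → ℝ} (hf : ∀ x, HasDerivAt f (f' x) x)
    (hf' : Continuous f') (hper : f (2 * π) = f 0) (hmean : ∫ x in (0)..(2 * π), f x = 0) :
    4 * (∫ x in (0)..(2 * π), f x ^ 2) - 3 / π * ((∫ x in (0)..(2 * π), f x * Real.cos x) ^ 2
      + (∫ x in (0)..(2 * π), f x * Real.sin x) ^ 2) ≤ ∫ x in (0)..(2 * π), f' x ^ 2 := by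
  have h0 : (0 : ℝ) < 2 * π := by positivity
  have hfc : Continuous f := continuous_iff_continuousAt.2 fun x => (hf x).continuousAt
  have parseval : ∀ g : ℝ → ℝ, Continuous g →
      HasSum (fun n => ‖fourierCoeffOn h0 (fun x => (g x : ℂ)) n‖ ^ 2)
        ((2 * π)⁻¹ * ∫ x in (0)..(2 * π), g x ^ 2) := by
    intro g hg
    have hgc : Continuous fun x => (g x : ℂ) := Complex.continuous_ofReal.comp hg
    have hL : MemLp (fun x => (g x : ℂ)) 2 (volume.restrict (Set.Ioc 0 (2 * π))) := by
      obtain ⟨C, hC⟩ := (isCompact_Icc (a := 0) (b := 2 * π)).exists_bound_of_continuousOn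
        hgc.continuousOn
      refine MemLp.of_bound hgc.aestronglyMeasurable C ?_
      filter_upwards [ae_restrict_mem measurableSet_Ioc] with x hx using
        hC x (Set.Ioc_subset_Icc_self hx)
    have := hasSum_sq_fourierCoeffOn h0 hL
    simpa using this
  have h1 := parseval f hfc
  have h2 := parseval f' hf'
  set c := fourierCoeffOn h0 (fun x => (f x : ℂ)) with hc
  set c' := fourierCoeffOn h0 (fun x => (f' x : ℂ)) with hc'
  have hc0 : c 0 = 0 := by
    rw [hc, fourierCoeffOn_eq_integral]
    simp [intervalIntegral.integral_ofReal, hmean]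
  have hcc : ∀ n : ℤ, n ≠ 0 → ‖c' n‖ ^ 2 = (n : ℝ) ^ 2 * ‖c n‖ ^ 2 := by
    intro n hn
    have := fourierCoeffOn_of_hasDerivAt h0 (f := fun x => (f x : ℂ)) (f' := fun x => (f' x : ℂ)) hn
      (fun x _ => (hf x).ofReal_comp)
      ((Complex.continuous_ofReal.comp hf').intervalIntegrable _ _)
    rw [← hc, ← hc', hper] at this
    have hn' : (n : ℂ) ≠ 0 := by exact_mod_cast hn
    have hpi : (π : ℂ) ≠ 0 := by exact_mod_cast Real.pi_ne_zero
    have h3 : c' n = Complex.I * n * c n := by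
      rw [this]
      have hI : Complex.I ≠ 0 := Complex.I_ne_zero
      push_cast
      field_simp
      ring
    rw [h3, norm_mul, norm_mul, mul_pow, mul_pow]
    simp
  have hmode : ∀ n : ℤ, n = 1 ∨ n = -1 → ‖c n‖ ^ 2 = 1 / (4 * π ^ 2) *
      ((∫ x in (0)..(2 * π), f x * Real.cos x) ^ 2
        + (∫ x in (0)..(2 * π), f x * Real.sin x) ^ 2) := by
    intro n hn
    have hcoef : c n = (1 / (2 * π) : ℝ) * (((∫ x in (0)..(2 * π), f x * Real.cos x : ℝ) : ℂ)
        - (n : ℝ) * Complex.I * (∫ x in (0)..(2 * π), f x * Real.sin x : ℝ)) := by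
      rw [hc, fourierCoeffOn_eq_integral, ← intervalIntegral.integral_ofReal,
        ← intervalIntegral.integral_ofReal, ← intervalIntegral.integral_const_mul,
        ← intervalIntegral.integral_sub
          (Continuous.intervalIntegrable (by fun_prop) _ _)
          (Continuous.intervalIntegrable (by fun_prop) _ _), Complex.real_smul]
      congr 1
      · simp
      · refine intervalIntegral.integral_congr fun x _ => ?_
        have hpi : (π : ℂ) ≠ 0 := by exact_mod_cast Real.pi_ne_zero
        have he : fourier (-n) (x : AddCircle (2 * π - 0))
            = Complex.exp (((-(n * x) : ℝ) : ℂ) * Complex.I) := by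
          rw [fourier_coe_apply]
          congr 1
          push_cast
          field_simp
          ring
        simp only [he, smul_eq_mul, Complex.exp_mul_I, ← Complex.ofReal_cos, ← Complex.ofReal_sin]
        rcases hn with rfl | rfl <;> simp <;> ring
    rw [hcoef, norm_mul, mul_pow, ← Complex.normSq_eq_norm_sq, ← Complex.normSq_eq_norm_sq,
      Complex.normSq_apply, Complex.normSq_apply]
    have hn2 : (n : ℝ) ^ 2 = 1 := by rcases hn with rfl | rfl <;> norm_num
    simp
    field_simp
    nlinarith
  have hfin := hasSum_sum_of_ne_finset_zero (L := .unconditional ℤ)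
    (f := fun n : ℤ => if n = 1 ∨ n = -1 then
    -3 * ‖c n‖ ^ 2 else 0) (s := {1, -1}) (by intro b hb; simp at hb; simp [hb])
  have hterm : ∀ n : ℤ, (if n = 1 ∨ n = -1 then -3 * ‖c n‖ ^ 2 else 0)
      ≤ ‖c' n‖ ^ 2 - 4 * ‖c n‖ ^ 2 := by
    intro n
    by_cases hn : n = 1 ∨ n = -1
    · rw [if_pos hn, hcc n (by omega)]
      have : (n : ℝ) ^ 2 = 1 := by rcases hn with rfl | rfl <;> norm_num
      rw [this]; linarith
    · rw [if_neg hn]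
      by_cases hn0 : n = 0
      · subst hn0; simp [hc0]
      · rw [hcc n hn0]
        have : (4 : ℝ) ≤ (n : ℝ) ^ 2 := by
          have : (4 : ℤ) ≤ n ^ 2 := by
            rcases lt_or_gt_of_ne hn0 with h | h
            · nlinarith [show n ≤ -2 by omega]
            · nlinarith [show 2 ≤ n by omega]
          exact_mod_cast this
        nlinarith [sq_nonneg ‖c n‖]
  have hle := hasSum_le hterm hfin (h2.sub (h1.mul_left 4))
  rw [Finset.sum_pair (by norm_num)] at hle
  simp only [true_or, or_true, if_true, hmode 1 (Or.inl rfl), hmode (-1) (Or.inr rfl)] at hle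
  have := mul_le_mul_of_nonneg_left hle h0.le
  field_simp at this ⊢
  linarith

/-- Bessel's inequality on the circle for the first Fourier mode. -/
theorem bessel_first_mode {q : ℝ → ℝ} (hq : Continuous q) :
    1 / π * ((∫ x in (0)..(2 * π), q x * Real.cos x) ^ 2
      + (∫ x in (0)..(2 * π), q x * Real.sin x) ^ 2) ≤ ∫ x in (0)..(2 * π), q x ^ 2 := by
  set A := ∫ x in (0)..(2 * π), q x * Real.cos x with hA
  set B := ∫ x in (0)..(2 * π), q x * Real.sin x with hB
  have hpos : 0 ≤ ∫ x in (0)..(2 * π), (q x - (A / π * Real.cos x + B / π * Real.sin x)) ^ 2 :=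
    intervalIntegral.integral_nonneg (by positivity) fun _ _ => sq_nonneg _
  have hexp : ∀ x, (q x - (A / π * Real.cos x + B / π * Real.sin x)) ^ 2
      = q x ^ 2 - 2 * A / π * (q x * Real.cos x) - 2 * B / π * (q x * Real.sin x)
        + ((A / π) ^ 2 * Real.cos x ^ 2 + (B / π) ^ 2 * Real.sin x ^ 2
          + 2 * A * B / π ^ 2 * (Real.sin x * Real.cos x)) := by
    intro x; ring
  simp_rw [hexp] at hpos
  have ii : ∀ {g : ℝ → ℝ}, Continuous g → IntervalIntegrable g volume 0 (2 * π) :=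
    fun h => h.intervalIntegrable _ _
  rw [intervalIntegral.integral_add (ii (by fun_prop)) (ii (by fun_prop)),
    intervalIntegral.integral_sub (ii (by fun_prop)) (ii (by fun_prop)),
    intervalIntegral.integral_sub (ii (by fun_prop)) (ii (by fun_prop)),
    intervalIntegral.integral_add (ii (by fun_prop)) (ii (by fun_prop)),
    intervalIntegral.integral_add (ii (by fun_prop)) (ii (by fun_prop))] at hpos
  simp only [intervalIntegral.integral_const_mul, ← hA, ← hB, integral_cos_sq, integral_sin_sq,
    integral_sin_mul_cos₁] at hpos
  simp at hpos
  have hpi := Real.pi_pos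
  field_simp at hpos ⊢
  nlinarith

/-- The sharp Poincaré inequality on `[-π/2, π/2]` for the weight `cos³`. -/
theorem poincare_cos_cube {A A' : ℝ → ℝ} (hA : ∀ x, HasDerivAt A (A' x) x) (hA' : Continuous A')
    (h0 : ∫ x in (-(π / 2))..(π / 2), Real.cos x ^ 3 * A x = 0) :
    4 * (∫ x in (-(π / 2))..(π / 2), Real.cos x ^ 3 * A x ^ 2)
      ≤ ∫ x in (-(π / 2))..(π / 2), Real.cos x ^ 3 * A' x ^ 2 := by
  have hpi := Real.pi_pos
  have hAc : Continuous A := continuous_iff_continuousAt.2 fun x => (hA x).continuousAt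
  set G : ℝ → ℝ := fun t => ∫ x in (-(π / 2))..t, Real.cos x ^ 3 * A x with hG
  have hwc : Continuous fun x => Real.cos x ^ 3 * A x := by fun_prop
  have hGd : ∀ t, HasDerivAt G (Real.cos t ^ 3 * A t) t := fun t =>
    hwc.integral_hasStrictDerivAt _ _ |>.hasDerivAt
  have hGc : Continuous G := continuous_iff_continuousAt.2 fun x => (hGd x).continuousAt
  have hGl : G (-(π / 2)) = 0 := by simp [hG]
  have hGr : G (π / 2) = 0 := h0
  obtain ⟨M, hM⟩ := (isCompact_Icc (a := -(π / 2)) (b := π / 2)).exists_bound_of_continuousOn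
    hAc.continuousOn
  have hM0 : 0 ≤ M := (norm_nonneg _).trans (hM 0 ⟨by linarith, by linarith⟩)
  have hGb : ∀ t ∈ Set.Icc (-(π / 2)) (π / 2), |G t| ≤ M * π * Real.cos t ^ 3 := by
    intro t ht
    have hct : 0 ≤ Real.cos t := Real.cos_nonneg_of_mem_Icc ht
    have key : ∀ s, s ∈ Set.Icc (-(π / 2)) (π / 2) → Real.cos s ≤ Real.cos t →
        ‖Real.cos s ^ 3 * A s‖ ≤ M * Real.cos t ^ 3 := by
      intro s hs hst
      have hcs : 0 ≤ Real.cos s := Real.cos_nonneg_of_mem_Icc hs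
      rw [norm_mul, norm_pow, Real.norm_of_nonneg hcs, mul_comm]
      gcongr
      exact hM s hs
    rcases le_total t 0 with h | h
    · have := intervalIntegral.norm_integral_le_of_norm_le_const (a := -(π / 2)) (b := t)
        (f := fun x => Real.cos x ^ 3 * A x) (C := M * Real.cos t ^ 3) (by
          intro s hs
          rw [Set.uIoc_of_le ht.1] at hs
          refine key s ⟨hs.1.le, hs.2.trans ht.2⟩ ?_
          rw [← Real.cos_neg s, ← Real.cos_neg t]
          exact Real.cos_le_cos_of_nonneg_of_le_pi (by linarith) (by linarith [hs.1])
            (by linarith [hs.2]))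
      refine this.trans ?_
      rw [abs_of_nonneg (by linarith [ht.1])]
      nlinarith [mul_nonneg hM0 (pow_nonneg hct 3), ht.1]
    · have := intervalIntegral.norm_integral_le_of_norm_le_const (a := t) (b := π / 2)
        (f := fun x => Real.cos x ^ 3 * A x) (C := M * Real.cos t ^ 3) (by
          intro s hs
          rw [Set.uIoc_of_le ht.2] at hs
          refine key s ⟨by linarith [hs.1], hs.2⟩ ?_
          exact Real.cos_le_cos_of_nonneg_of_le_pi h (by linarith [hs.2]) hs.1.le)
      have hGt : G t = - ∫ x in t..(π / 2), Real.cos x ^ 3 * A x := by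
        have := intervalIntegral.integral_add_adjacent_intervals
          (hwc.intervalIntegrable (μ := volume) (-(π / 2)) t) (hwc.intervalIntegrable t (π / 2))
        rw [h0] at this
        simp only [hG]; linarith
      rw [hGt, abs_neg]
      refine this.trans ?_
      rw [abs_of_nonneg (by linarith [ht.2])]
      nlinarith [mul_nonneg hM0 (pow_nonneg hct 3), ht.2]
  set W : ℝ → ℝ := fun t => Real.sin t * G t ^ 2 / Real.cos t ^ 4 with hW
  have hWb : ∀ t ∈ Set.Icc (-(π / 2)) (π / 2), ‖W t‖ ≤ (M * π) ^ 2 * Real.cos t ^ 2 := by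
    intro t ht
    have hct : 0 ≤ Real.cos t := Real.cos_nonneg_of_mem_Icc ht
    have hs := Real.abs_sin_le_one t
    rcases hct.eq_or_lt with h | h
    · simp [hW, ← h]
    · simp only [hW, norm_div, norm_mul, norm_pow, Real.norm_eq_abs, abs_of_pos h]
      rw [div_le_iff₀ (by positivity)]
      calc |Real.sin t| * |G t| ^ 2 ≤ 1 * (M * π * Real.cos t ^ 3) ^ 2 := by
            gcongr; exact hGb t ht
        _ = _ := by ring
  have hcos_pos : ∀ t ∈ Set.Ioo (-(π / 2)) (π / 2), 0 < Real.cos t := fun t ht =>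
    Real.cos_pos_of_mem_Ioo ht
  have hWc : ContinuousOn W (Set.Icc (-(π / 2)) (π / 2)) := by
    have hend : ∀ t ∈ Set.Icc (-(π / 2)) (π / 2), Real.cos t = 0 →
        ContinuousWithinAt W (Set.Icc (-(π / 2)) (π / 2)) t := by
      intro t ht h
      have hWt : W t = 0 := by simp [hW, h]
      rw [ContinuousWithinAt, hWt]
      refine squeeze_zero_norm' (a := fun t => (M * π) ^ 2 * Real.cos t ^ 2) ?_ ?_
      · filter_upwards [self_mem_nhdsWithin] with s hs using hWb s hs
      · have : Continuous fun t => (M * π) ^ 2 * Real.cos t ^ 2 := by fun_prop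
        have h2 := this.continuousWithinAt (s := Set.Icc (-(π / 2)) (π / 2)) (x := t)
        rw [ContinuousWithinAt] at h2
        simpa [h] using h2
    intro t ht
    by_cases h : Real.cos t = 0
    · exact hend t ht h
    · refine ContinuousAt.continuousWithinAt ?_
      exact ContinuousAt.div (by fun_prop) (by fun_prop) (by positivity)
  set k : ℝ → ℝ := fun x => Real.cos x ^ 3 * A' x ^ 2 + 8 * (A' x * G x)
    + 4 * (Real.cos x ^ 3 * A x ^ 2) with hk
  have hkc : Continuous k := by fun_prop
  have hmono : MonotoneOn (fun t => (∫ x in (-(π / 2))..t, k x) + 16 * W t)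
      (Set.Icc (-(π / 2)) (π / 2)) := by
    have hd : ∀ t ∈ Set.Ioo (-(π / 2)) (π / 2),
        HasDerivAt (fun t => (∫ x in (-(π / 2))..t, k x) + 16 * W t)
          (Real.cos t ^ 3 * (A' t + 4 * G t / Real.cos t ^ 3) ^ 2
            + 4 * Real.cos t ^ 3 * (A t + 4 * Real.sin t * G t / Real.cos t ^ 4) ^ 2) t := by
      intro t ht
      have hc := (hcos_pos t ht).ne'
      have h1 : HasDerivAt (fun t => ∫ x in (-(π / 2))..t, k x) (k t) t :=
        hkc.integral_hasStrictDerivAt _ _ |>.hasDerivAt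
      have h2 := (((Real.hasDerivAt_sin t).mul ((hGd t).pow 2)).div
        ((Real.hasDerivAt_cos t).pow 4) (pow_ne_zero 4 hc)).const_mul 16
      refine (h1.add h2).congr_deriv ?_
      simp only [hk]
      simp
      field_simp
      ring
    refine monotoneOn_of_deriv_nonneg (convex_Icc _ _) ?_ ?_ ?_
    · refine ContinuousOn.add ?_ (continuousOn_const.mul hWc)
      exact (continuous_iff_continuousAt.2 fun t =>
        (hkc.integral_hasStrictDerivAt _ t).hasDerivAt.continuousAt).continuousOn
    · rw [interior_Icc]
      exact fun t ht => (hd t ht).differentiableAt.differentiableWithinAt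
    · rw [interior_Icc]
      intro t ht
      rw [(hd t ht).deriv]
      have := hcos_pos t ht
      positivity
  have hfin := hmono (a := -(π / 2)) (b := π / 2) ⟨le_rfl, by linarith⟩ ⟨by linarith, le_rfl⟩
    (by linarith)
  have hW1 : W (-(π / 2)) = 0 := by simp [hW]
  have hW2 : W (π / 2) = 0 := by simp [hW]
  simp only [hW1, hW2, intervalIntegral.integral_same, hk] at hfin
  have hparts := intervalIntegral.integral_mul_deriv_eq_deriv_mul (a := -(π / 2)) (b := π / 2)
    (u := G) (v := A) (fun x _ => hGd x) (fun x _ => hA x) (hwc.intervalIntegrable _ _)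
    (hA'.intervalIntegrable _ _)
  rw [hGl, hGr] at hparts
  have ii : ∀ {g : ℝ → ℝ}, Continuous g → IntervalIntegrable g volume (-(π / 2)) (π / 2) :=
    fun h => h.intervalIntegrable _ _
  rw [intervalIntegral.integral_add (ii (by fun_prop)) (ii (by fun_prop)),
    intervalIntegral.integral_add (ii (by fun_prop)) (ii (by fun_prop)),
    intervalIntegral.integral_const_mul, intervalIntegral.integral_const_mul] at hfin
  have e1 : ∫ x in (-(π / 2))..(π / 2), A' x * G x = ∫ x in (-(π / 2))..(π / 2), G x * A' x :=
    intervalIntegral.integral_congr fun x _ => mul_comm _ _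
  have e2 : ∫ x in (-(π / 2))..(π / 2), Real.cos x ^ 3 * A x * A x
      = ∫ x in (-(π / 2))..(π / 2), Real.cos x ^ 3 * A x ^ 2 :=
    intervalIntegral.integral_congr fun x _ => by ring
  rw [e1, hparts, e2] at hfin
  linarith

/-- The spectral gap inequality for the first longitudinal mode. -/
theorem first_mode_gap {A A' : ℝ → ℝ} (hA : ∀ x, HasDerivAt A (A' x) x) (hA' : Continuous A')
    (h0 : ∫ x in (-(π / 2))..(π / 2), Real.cos x ^ 3 * A x = 0) :
    3 * (∫ x in (-(π / 2))..(π / 2), Real.cos x * A x ^ 2)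
      ≤ ∫ x in (-(π / 2))..(π / 2), Real.cos x * (Real.cos x * A' x + Real.sin x * A x) ^ 2 := by
  have hAc : Continuous A := continuous_iff_continuousAt.2 fun x => (hA x).continuousAt
  have hp := poincare_cos_cube hA hA' h0
  have ii : ∀ {g : ℝ → ℝ}, Continuous g → IntervalIntegrable g volume (-(π / 2)) (π / 2) :=
    fun h => h.intervalIntegrable _ _
  have hB := intervalIntegral.integral_eq_sub_of_hasDerivAt (a := -(π / 2)) (b := π / 2)
    (f := fun x => Real.cos x ^ 2 * Real.sin x * A x ^ 2)
    (f' := fun x => Real.cos x * (Real.cos x * A' x + Real.sin x * A x) ^ 2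
      - 3 * (Real.cos x * A x ^ 2)
      - (Real.cos x ^ 3 * A' x ^ 2 - 4 * (Real.cos x ^ 3 * A x ^ 2))) (fun x _ => by
      refine ((((Real.hasDerivAt_cos x).pow 2).mul (Real.hasDerivAt_sin x)).mul
        ((hA x).pow 2)).congr_deriv ?_
      have := Real.sin_sq x
      simp
      grind) (ii (by fun_prop))
  rw [intervalIntegral.integral_sub (ii (by fun_prop)) (ii (by fun_prop)),
    intervalIntegral.integral_sub (ii (by fun_prop)) (ii (by fun_prop)),
    intervalIntegral.integral_sub (ii (by fun_prop)) (ii (by fun_prop)),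
    intervalIntegral.integral_const_mul, intervalIntegral.integral_const_mul] at hB
  simp at hB
  linarith

/-- Differentiation under an interval integral with a jointly continuous derivative. -/
theorem hasDerivAt_intervalIntegral_snd {f f' : ℝ × ℝ → ℝ} (hf : Continuous f)
    (hf' : Continuous f') (h : ∀ x t, HasDerivAt (fun s => f (x, s)) (f' (x, t)) t) (a b t : ℝ) :
    HasDerivAt (fun s => ∫ x in a..b, f (x, s)) (∫ x in a..b, f' (x, t)) t := by
  obtain ⟨C, hC⟩ := (isCompact_uIcc (a := a) (b := b)).prod
    (isCompact_closedBall t 1) |>.exists_bound_of_continuousOn hf'.continuousOn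
  refine (intervalIntegral.hasDerivAt_integral_of_dominated_loc_of_deriv_le
    (F := fun s x => f (x, s)) (F' := fun s x => f' (x, s)) (bound := fun _ => C)
    (Metric.ball_mem_nhds t one_pos) (Filter.Eventually.of_forall fun s => ?_) ?_ ?_ ?_ ?_ ?_).2
  · exact Continuous.aestronglyMeasurable (by fun_prop)
  · exact Continuous.intervalIntegrable (by fun_prop) _ _
  · exact Continuous.aestronglyMeasurable (by fun_prop)
  · exact Filter.Eventually.of_forall fun x hx s hs =>
      hC (x, s) ⟨Set.uIoc_subset_uIcc hx, Metric.ball_subset_closedBall hs⟩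
  · exact intervalIntegrable_const
  · exact Filter.Eventually.of_forall fun x _ s _ => h x s

/-- The integral over the coordinate rectangle of longitudes `[0, 2π]` and latitudes
`[-π/2, π/2]`. -/
def rectInt (f : ℝ × ℝ → ℝ) : ℝ :=
  ∫ θ in (-(π / 2))..(π / 2), ∫ φ in (0)..(2 * π), f (φ, θ)

theorem continuous_intervalIntegral_fst {X : Type*} [TopologicalSpace X] {f : ℝ × X → ℝ}
    (hf : Continuous f) (a b : ℝ) : Continuous fun t => ∫ x in a..b, f (x, t) :=
  intervalIntegral.continuous_parametric_intervalIntegral_of_continuous' (μ := volume)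
    (f := fun t x => f (x, t)) (by fun_prop) a b

theorem rectInt_add {f g : ℝ × ℝ → ℝ} (hf : Continuous f) (hg : Continuous g) :
    rectInt (fun z => f z + g z) = rectInt f + rectInt g := by
  simp only [rectInt]
  rw [← intervalIntegral.integral_add
    ((continuous_intervalIntegral_fst hf _ _).intervalIntegrable _ _)
    ((continuous_intervalIntegral_fst hg _ _).intervalIntegrable _ _)]
  refine intervalIntegral.integral_congr fun θ _ => ?_
  exact intervalIntegral.integral_add (Continuous.intervalIntegrable (by fun_prop) _ _)
    (Continuous.intervalIntegrable (by fun_prop) _ _)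

theorem rectInt_const_mul (c : ℝ) (f : ℝ × ℝ → ℝ) :
    rectInt (fun z => c * f z) = c * rectInt f := by
  simp only [rectInt, intervalIntegral.integral_const_mul]

theorem rectInt_congr {f g : ℝ × ℝ → ℝ}
    (h : ∀ φ, ∀ θ ∈ Set.Icc (-(π / 2)) (π / 2), f (φ, θ) = g (φ, θ)) :
    rectInt f = rectInt g := by
  refine intervalIntegral.integral_congr fun θ hθ => ?_
  rw [Set.uIcc_of_le (by linarith [Real.pi_pos])] at hθ
  exact intervalIntegral.integral_congr fun φ _ => h φ θ hθ

theorem rectInt_eq_zero_of_hasDerivAt_fst {g g' : ℝ × ℝ → ℝ} (hg' : Continuous g')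
    (h : ∀ φ θ, HasDerivAt (fun t => g (t, θ)) (g' (φ, θ)) φ)
    (hper : ∀ θ, g (2 * π, θ) = g (0, θ)) : rectInt g' = 0 := by
  have : ∀ θ, ∫ φ in (0)..(2 * π), g' (φ, θ) = 0 := fun θ => by
    rw [intervalIntegral.integral_eq_sub_of_hasDerivAt (fun φ _ => h φ θ)
      (Continuous.intervalIntegrable (by fun_prop) _ _), hper, sub_self]
  simp [rectInt, this]

theorem rectInt_eq_zero_of_hasDerivAt_snd {g g' : ℝ × ℝ → ℝ} (hg' : Continuous g')
    (h : ∀ φ θ, HasDerivAt (fun t => g (φ, t)) (g' (φ, θ)) θ)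
    (h₁ : ∀ φ, g (φ, -(π / 2)) = 0) (h₂ : ∀ φ, g (φ, π / 2) = 0) : rectInt g' = 0 := by
  have : ∀ φ, ∫ θ in (-(π / 2))..(π / 2), g' (φ, θ) = 0 := fun φ => by
    rw [intervalIntegral.integral_eq_sub_of_hasDerivAt (fun θ _ => h φ θ)
      (Continuous.intervalIntegrable (by fun_prop) _ _), h₁, h₂, sub_self]
  rw [rectInt, intervalIntegral_intervalIntegral_swap]
  · simp [this]
  · refine IntegrableOn.mono_set (t := Set.uIcc _ _ ×ˢ Set.uIcc _ _) ?_
      (Set.prod_mono Set.uIoc_subset_uIcc Set.uIoc_subset_uIcc)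
    exact ContinuousOn.integrableOn_compact (isCompact_uIcc.prod isCompact_uIcc)
      (Continuous.continuousOn (by fun_prop))

theorem eq_zero_of_rectInt_nonpos {f : ℝ × ℝ → ℝ} (hf : Continuous f)
    (h : ∀ φ, ∀ θ ∈ Set.Icc (-(π / 2)) (π / 2), 0 ≤ f (φ, θ)) (h0 : rectInt f ≤ 0)
    {φ θ : ℝ} (hφ : φ ∈ Set.Icc 0 (2 * π)) (hθ : θ ∈ Set.Icc (-(π / 2)) (π / 2)) :
    f (φ, θ) = 0 := by
  by_contra hne
  have hpos : 0 < f (φ, θ) := lt_of_le_of_ne (h φ θ hθ) (Ne.symm hne)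
  have hpi := Real.pi_pos
  refine absurd h0 (not_le.2 ?_)
  refine intervalIntegral.integral_pos (by linarith)
    (continuous_intervalIntegral_fst hf _ _).continuousOn (fun t ht => ?_) ⟨θ, hθ, ?_⟩
  · exact intervalIntegral.integral_nonneg (by linarith) fun x _ => h x t ⟨ht.1.le, ht.2⟩
  · exact intervalIntegral.integral_pos (by linarith) (Continuous.continuousOn (by fun_prop))
      (fun x _ => h x θ hθ) ⟨φ, hφ, hpos⟩

/-- The partial derivative in the first variable. -/
def pderivFst (f : ℝ × ℝ → ℝ) (z : ℝ × ℝ) : ℝ := fderiv ℝ f z (1, 0)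

/-- The partial derivative in the second variable. -/
def pderivSnd (f : ℝ × ℝ → ℝ) (z : ℝ × ℝ) : ℝ := fderiv ℝ f z (0, 1)

open scoped ContDiff

theorem ContDiff.pderivFst {f : ℝ × ℝ → ℝ} (hf : ContDiff ℝ ∞ f) : ContDiff ℝ ∞ (pderivFst f) :=
  (hf.fderiv_right (by simp)).clm_apply contDiff_const

theorem ContDiff.pderivSnd {f : ℝ × ℝ → ℝ} (hf : ContDiff ℝ ∞ f) : ContDiff ℝ ∞ (pderivSnd f) :=
  (hf.fderiv_right (by simp)).clm_apply contDiff_const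

theorem hasDerivAt_pderivFst {f : ℝ × ℝ → ℝ} (hf : ContDiff ℝ ∞ f) (x y : ℝ) :
    HasDerivAt (fun t => f (t, y)) (pderivFst f (x, y)) x := by
  have h := (hf.differentiable (by simp) (x, y)).hasFDerivAt
  exact h.comp_hasDerivAt x ((hasDerivAt_id x).prodMk (hasDerivAt_const x y))

theorem hasDerivAt_pderivSnd {f : ℝ × ℝ → ℝ} (hf : ContDiff ℝ ∞ f) (x y : ℝ) :
    HasDerivAt (fun t => f (x, t)) (pderivSnd f (x, y)) y := by
  have h := (hf.differentiable (by simp) (x, y)).hasFDerivAt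
  exact h.comp_hasDerivAt y ((hasDerivAt_const y x).prodMk (hasDerivAt_id y))

theorem pderivFst_pderivSnd {f : ℝ × ℝ → ℝ} (hf : ContDiff ℝ ∞ f) :
    pderivFst (pderivSnd f) = pderivSnd (pderivFst f) := by
  funext z
  have hd : Differentiable ℝ (fderiv ℝ f) :=
    (hf.fderiv_right (m := ∞) (by simp)).differentiable (by simp)
  have hsymm := second_derivative_symmetric (f := f) (f' := fderiv ℝ f)
    (fun y => (hf.differentiable (by simp) y).hasFDerivAt) (hd z).hasFDerivAt (1, 0) (0, 1)
  unfold pderivFst pderivSnd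
  rw [fderiv_clm_apply (hd z) (by fun_prop), fderiv_clm_apply (hd z) (by fun_prop)]
  simpa using hsymm

/-- The second spectral gap of the sphere: for `u = cos θ · p` with vanishing longitudinal means
and orthogonal to the first spherical harmonics, the Dirichlet energy is at least `6 ‖u‖²`
(after completing the square in latitude). -/
theorem rectInt_gap {p : ℝ × ℝ → ℝ} (hp : ContDiff ℝ ∞ p)
    (hper : ∀ φ θ, p (φ + 2 * π, θ) = p (φ, θ))
    (hmean : ∀ θ ∈ Set.Ioo (-(π / 2)) (π / 2), ∫ φ in (0)..(2 * π), p (φ, θ) = 0)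
    (hcos : rectInt (fun z => Real.cos z.2 ^ 3 * (p z * Real.cos z.1)) = 0)
    (hsin : rectInt (fun z => Real.cos z.2 ^ 3 * (p z * Real.sin z.1)) = 0) :
    0 ≤ rectInt (fun z => Real.cos z.2 * ((Real.cos z.2 * pderivSnd p z + Real.sin z.2 * p z) ^ 2
      - 4 * p z ^ 2 + pderivFst p z ^ 2)) := by
  have hpi := Real.pi_pos
  have cp : Continuous p := hp.continuous
  have c1 : Continuous (pderivFst p) := hp.pderivFst.continuous
  have c2 : Continuous (pderivSnd p) := hp.pderivSnd.continuous
  have mode : ∀ w : ℝ → ℝ, Continuous w →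
      rectInt (fun z => Real.cos z.2 ^ 3 * (p z * w z.1)) = 0 →
      0 ≤ ∫ θ in (-(π / 2))..(π / 2), Real.cos θ *
        ((∫ φ in (0)..(2 * π), (Real.cos θ * pderivSnd p (φ, θ) + Real.sin θ * p (φ, θ)) * w φ) ^ 2
          - 3 * (∫ φ in (0)..(2 * π), p (φ, θ) * w φ) ^ 2) := by
    intro w hw h0
    have hA := fun θ => hasDerivAt_intervalIntegral_snd (f := fun z => p z * w z.1)
      (f' := fun z => pderivSnd p z * w z.1) (by fun_prop) (by fun_prop)
      (fun x t => (hasDerivAt_pderivSnd hp x t).mul_const (w x)) 0 (2 * π) θ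
    have cA := continuous_intervalIntegral_fst (f := fun z : ℝ × ℝ => p z * w z.1)
      (by fun_prop) 0 (2 * π)
    have cA' := continuous_intervalIntegral_fst (f := fun z : ℝ × ℝ => pderivSnd p z * w z.1)
      (by fun_prop) 0 (2 * π)
    have hgap := first_mode_gap hA cA' (by simpa [rectInt] using h0)
    have hsplit : ∀ θ, ∫ φ in (0)..(2 * π),
        (Real.cos θ * pderivSnd p (φ, θ) + Real.sin θ * p (φ, θ)) * w φ
        = Real.cos θ * (∫ φ in (0)..(2 * π), pderivSnd p (φ, θ) * w φ)
          + Real.sin θ * ∫ φ in (0)..(2 * π), p (φ, θ) * w φ := by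
      intro θ
      rw [← intervalIntegral.integral_const_mul, ← intervalIntegral.integral_const_mul,
        ← intervalIntegral.integral_add (Continuous.intervalIntegrable (by fun_prop) _ _)
          (Continuous.intervalIntegrable (by fun_prop) _ _)]
      exact intervalIntegral.integral_congr fun φ _ => by ring
    simp only [hsplit, mul_sub]
    rw [intervalIntegral.integral_sub (Continuous.intervalIntegrable (by fun_prop) _ _)
      (Continuous.intervalIntegrable (by fun_prop) _ _)]
    simp only [mul_left_comm _ (3 : ℝ), intervalIntegral.integral_const_mul]
    exact sub_nonneg.2 hgap
  have hC := mode _ Real.continuous_cos hcos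
  have hS := mode _ Real.continuous_sin hsin
  have cq : ∀ w : ℝ → ℝ, Continuous w → Continuous fun θ => ∫ φ in (0)..(2 * π),
      (Real.cos θ * pderivSnd p (φ, θ) + Real.sin θ * p (φ, θ)) * w φ := fun w hw =>
    continuous_intervalIntegral_fst (f := fun z : ℝ × ℝ =>
      (Real.cos z.2 * pderivSnd p z + Real.sin z.2 * p z) * w z.1) (by fun_prop) 0 (2 * π)
  have cpw : ∀ w : ℝ → ℝ, Continuous w → Continuous fun θ => ∫ φ in (0)..(2 * π),
      p (φ, θ) * w φ := fun w hw =>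
    continuous_intervalIntegral_fst (f := fun z : ℝ × ℝ => p z * w z.1) (by fun_prop) 0 (2 * π)
  have cqc := cq _ Real.continuous_cos
  have cqs := cq _ Real.continuous_sin
  have cpc := cpw _ Real.continuous_cos
  have cps := cpw _ Real.continuous_sin
  have hsum := mul_nonneg (one_div_pos.2 hpi).le (add_nonneg hC hS)
  rw [← intervalIntegral.integral_add (Continuous.intervalIntegrable (by fun_prop) _ _)
    (Continuous.intervalIntegrable (by fun_prop) _ _), ← intervalIntegral.integral_const_mul]
    at hsum
  refine hsum.trans ?_
  refine intervalIntegral.integral_mono_on_of_le_Ioo (by linarith)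
    (Continuous.intervalIntegrable (by fun_prop) _ _)
    ((continuous_intervalIntegral_fst (f := fun z : ℝ × ℝ => Real.cos z.2 *
      ((Real.cos z.2 * pderivSnd p z + Real.sin z.2 * p z) ^ 2
        - 4 * p z ^ 2 + pderivFst p z ^ 2)) (by fun_prop) _ _).intervalIntegrable _ _) fun θ hθ => ?_
  have hct := Real.cos_pos_of_mem_Ioo hθ
  have hW := wirtinger_second_mode (fun x => hasDerivAt_pderivFst hp x θ) (by fun_prop)
    (by simpa using hper 0 θ) (hmean θ hθ)
  have hB := bessel_first_mode
    (q := fun φ => Real.cos θ * pderivSnd p (φ, θ) + Real.sin θ * p (φ, θ)) (by fun_prop)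
  simp only [intervalIntegral.integral_const_mul]
  rw [intervalIntegral.integral_add (Continuous.intervalIntegrable (by fun_prop) _ _)
    (Continuous.intervalIntegrable (by fun_prop) _ _),
    intervalIntegral.integral_sub (Continuous.intervalIntegrable (by fun_prop) _ _)
    (Continuous.intervalIntegrable (by fun_prop) _ _), intervalIntegral.integral_const_mul,
    ← mul_add, mul_left_comm]
  refine mul_le_mul_of_nonneg_left ?_ hct.le
  ring_nf at hW hB ⊢
  linarith

/-- A solution of `ΔΨ = F(Ψ)` in coordinates with `F' > -6`, whose first spherical moments
transverse to the axis vanish, does not depend on longitude. Here `∂Ψ/∂φ = cos θ · p`. -/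
theorem longitude_independent {Ψ p : ℝ × ℝ → ℝ} {F : ℝ → ℝ} (hΨ : ContDiff ℝ ∞ Ψ)
    (hp : ContDiff ℝ ∞ p) (hF : ContDiff ℝ 1 F) (hF' : ∀ s, deriv F s > -6)
    (hperΨ : ∀ φ θ, Ψ (φ + 2 * π, θ) = Ψ (φ, θ))
    (hperp : ∀ φ θ, p (φ + 2 * π, θ) = p (φ, θ))
    (hu : ∀ z, pderivFst Ψ z = Real.cos z.2 * p z)
    (hpde : ∀ φ, ∀ θ ∈ Set.Ioo (-(π / 2)) (π / 2),
      Real.cos θ * pderivSnd (pderivSnd Ψ) (φ, θ) - Real.sin θ * pderivSnd Ψ (φ, θ)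
        + pderivFst p (φ, θ) = Real.cos θ * F (Ψ (φ, θ)))
    (hc : rectInt (fun z => Ψ z * (Real.cos z.1 * Real.cos z.2) * Real.cos z.2) = 0)
    (hs : rectInt (fun z => Ψ z * (Real.sin z.1 * Real.cos z.2) * Real.cos z.2) = 0)
    {φ θ : ℝ} (hφ : φ ∈ Set.Icc 0 (2 * π)) (hθ : θ ∈ Set.Ioo (-(π / 2)) (π / 2)) :
    p (φ, θ) = 0 := by
  have cΨ : Continuous Ψ := hΨ.continuous
  have cp : Continuous p := hp.continuous
  have cp1 : Continuous (pderivFst p) := hp.pderivFst.continuous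
  have cp2 : Continuous (pderivSnd p) := hp.pderivSnd.continuous
  have cp11 : Continuous (pderivFst (pderivFst p)) := hp.pderivFst.pderivFst.continuous
  have cp22 : Continuous (pderivSnd (pderivSnd p)) := hp.pderivSnd.pderivSnd.continuous
  have cF' : Continuous (deriv F) := hF.continuous_deriv le_rfl
  have hcosd := fun x : ℝ => Real.hasDerivAt_cos x
  have hsind := fun x : ℝ => Real.hasDerivAt_sin x
  have hm : ∀ φ θ, pderivSnd (pderivFst Ψ) (φ, θ)
      = Real.cos θ * pderivSnd p (φ, θ) - Real.sin θ * p (φ, θ) := by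
    intro φ θ
    have h1 := hasDerivAt_pderivSnd hΨ.pderivFst φ θ
    simp only [hu] at h1
    refine h1.unique (((hcosd θ).mul (hasDerivAt_pderivSnd hp φ θ)).congr_deriv ?_)
    ring
  have hmm : ∀ φ θ, pderivSnd (pderivSnd (pderivFst Ψ)) (φ, θ)
      = Real.cos θ * pderivSnd (pderivSnd p) (φ, θ) - 2 * Real.sin θ * pderivSnd p (φ, θ)
        - Real.cos θ * p (φ, θ) := by
    intro φ θ
    have h1 := hasDerivAt_pderivSnd hΨ.pderivFst.pderivSnd φ θ
    simp only [hm] at h1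
    refine h1.unique ((((hcosd θ).mul (hasDerivAt_pderivSnd hp.pderivSnd φ θ)).sub
      ((hsind θ).mul (hasDerivAt_pderivSnd hp φ θ))).congr_deriv ?_)
    ring
  have hlin : ∀ φ, ∀ θ ∈ Set.Ioo (-(π / 2)) (π / 2),
      Real.cos θ * (Real.cos θ * pderivSnd (pderivSnd p) (φ, θ)
          - 2 * Real.sin θ * pderivSnd p (φ, θ) - Real.cos θ * p (φ, θ))
        - Real.sin θ * (Real.cos θ * pderivSnd p (φ, θ) - Real.sin θ * p (φ, θ))
        + pderivFst (pderivFst p) (φ, θ)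
      = Real.cos θ ^ 2 * deriv F (Ψ (φ, θ)) * p (φ, θ) := by
    intro φ θ hθ
    have hl := (((hasDerivAt_pderivFst hΨ.pderivSnd.pderivSnd φ θ).const_mul (Real.cos θ)).sub
      ((hasDerivAt_pderivFst hΨ.pderivSnd φ θ).const_mul (Real.sin θ))).add
      (hasDerivAt_pderivFst hp.pderivFst φ θ)
    have hr := ((hF.differentiable (by simp) (Ψ (φ, θ))).hasDerivAt.comp φ
      (hasDerivAt_pderivFst hΨ φ θ)).const_mul (Real.cos θ)
    have he := (hl.congr_of_eventuallyEq (Filter.Eventually.of_forall fun t =>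
      (hpde t θ hθ).symm)).unique hr
    rw [pderivFst_pderivSnd hΨ.pderivSnd, pderivFst_pderivSnd hΨ, hmm, hm, hu] at he
    rw [he]
    ring
  have hmean : ∀ θ ∈ Set.Ioo (-(π / 2)) (π / 2), ∫ φ in (0)..(2 * π), p (φ, θ) = 0 := by
    intro θ hθ
    have h := intervalIntegral.integral_eq_sub_of_hasDerivAt (a := 0) (b := 2 * π)
      (fun φ _ => hasDerivAt_pderivFst hΨ φ θ)
      (Continuous.intervalIntegrable (by simp only [hu]; fun_prop) _ _)
    have hper := hperΨ 0 θ
    rw [zero_add] at hper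
    simp only [hu, intervalIntegral.integral_const_mul, hper, sub_self] at h
    exact (mul_eq_zero.1 h).resolve_left (Real.cos_pos_of_mem_Ioo hθ).ne'
  have moment : ∀ w w' : ℝ → ℝ, Continuous w → Continuous w' →
      (∀ x, HasDerivAt w (w' x) x) → w (2 * π) = w 0 →
      rectInt (fun z => Ψ z * (w' z.1 * Real.cos z.2) * Real.cos z.2) = 0 →
      rectInt (fun z => Real.cos z.2 ^ 3 * (p z * w z.1)) = 0 := by
    intro w w' cw cw' hw hwper h0
    have h1 := rectInt_eq_zero_of_hasDerivAt_fst
      (g := fun z => Real.cos z.2 ^ 2 * (Ψ z * w z.1))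
      (g' := fun z => Real.cos z.2 ^ 3 * (p z * w z.1)
        + Ψ z * (w' z.1 * Real.cos z.2) * Real.cos z.2) (by fun_prop)
      (fun φ θ => by
        refine (((hasDerivAt_pderivFst hΨ φ θ).mul (hw φ)).const_mul (Real.cos θ ^ 2)).congr_deriv ?_
        simp only [hu]
        ring) (fun θ => by
        have := hperΨ 0 θ
        rw [zero_add] at this
        simp only [this, hwper])
    rwa [rectInt_add (by fun_prop) (by fun_prop), h0, add_zero] at h1
  have hgap := rectInt_gap hp hperp hmean
    (moment _ (fun x => -Real.sin x) (by fun_prop) (by fun_prop) hcosd (by simp) (by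
      rw [← neg_eq_zero, ← hs, ← neg_one_mul, ← rectInt_const_mul]
      congr 1; funext z; ring))
    (moment _ Real.cos (by fun_prop) (by fun_prop) hsind (by simp) hc)
  have hθint := rectInt_eq_zero_of_hasDerivAt_snd
    (g := fun z => Real.cos z.2 ^ 2 * ((Real.cos z.2 * pderivSnd p z - Real.sin z.2 * p z) * p z)
      + 2 * (Real.cos z.2 ^ 2 * Real.sin z.2 * p z ^ 2))
    (g' := fun z => Real.cos z.2 * p z * (Real.cos z.2 * (Real.cos z.2 * pderivSnd (pderivSnd p) z
          - 2 * Real.sin z.2 * pderivSnd p z - Real.cos z.2 * p z)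
        - Real.sin z.2 * (Real.cos z.2 * pderivSnd p z - Real.sin z.2 * p z))
        + Real.cos z.2 * ((Real.cos z.2 * pderivSnd p z + Real.sin z.2 * p z) ^ 2 - 4 * p z ^ 2)
        + 6 * Real.cos z.2 ^ 3 * p z ^ 2)
    (by fun_prop) (fun φ θ => by
      refine ((((hcosd θ).pow 2).mul ((((hcosd θ).mul (hasDerivAt_pderivSnd hp.pderivSnd φ θ)).sub
        ((hsind θ).mul (hasDerivAt_pderivSnd hp φ θ))).mul (hasDerivAt_pderivSnd hp φ θ))).add
        (((((hcosd θ).pow 2).mul (hsind θ)).mul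
          ((hasDerivAt_pderivSnd hp φ θ).pow 2)).const_mul 2)).congr_deriv ?_
      have := Real.sin_sq θ
      simp
      grind)
    (by simp) (by simp)
  have hφint := rectInt_eq_zero_of_hasDerivAt_fst
    (g := fun z => Real.cos z.2 * (p z * pderivFst p z))
    (g' := fun z => Real.cos z.2 * pderivFst p z ^ 2
      + Real.cos z.2 * p z * pderivFst (pderivFst p) z) (by fun_prop)
    (fun φ θ => by
      refine (((hasDerivAt_pderivFst hp φ θ).mul
        (hasDerivAt_pderivFst hp.pderivFst φ θ)).const_mul (Real.cos θ)).congr_deriv ?_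
      ring)
    (fun θ => by
      have h1 : ∀ φ, pderivFst p (φ + 2 * π, θ) = pderivFst p (φ, θ) := fun φ => by
        have := (hasDerivAt_pderivFst hp (φ + 2 * π) θ).comp_add_const φ (2 * π)
        simp only [hperp] at this
        exact this.unique (hasDerivAt_pderivFst hp φ θ)
      have h2 := h1 0
      have h3 := hperp 0 θ
      rw [zero_add] at h2 h3
      simp only [h2, h3])
  set R : ℝ × ℝ → ℝ := fun z => Real.cos z.2 ^ 3 * (deriv F (Ψ z) + 6) * p z ^ 2 with hR
  have cR : Continuous R := by fun_prop
  have htot := congrArg₂ (· + ·) hθint hφint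
  simp only [add_zero] at htot
  rw [← rectInt_add (by fun_prop) (by fun_prop), rectInt_congr (g := fun z =>
    Real.cos z.2 * ((Real.cos z.2 * pderivSnd p z + Real.sin z.2 * p z) ^ 2
      - 4 * p z ^ 2 + pderivFst p z ^ 2) + R z) (fun φ θ hθ => by
      rcases (Real.cos_nonneg_of_mem_Icc hθ).eq_or_lt with h | h
      · simp [hR, ← h]
      · have hθ' : θ ∈ Set.Ioo (-(π / 2)) (π / 2) := by
          refine ⟨lt_of_le_of_ne hθ.1 ?_, lt_of_le_of_ne hθ.2 ?_⟩
          · rintro rfl; simp at h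
          · rintro rfl; simp at h
        have := hlin φ θ hθ'
        simp only [hR]
        linear_combination Real.cos θ * p (φ, θ) * this),
    rectInt_add (by fun_prop) cR] at htot
  have hR0 := eq_zero_of_rectInt_nonpos cR (fun φ θ hθ => by
    have h1 := Real.cos_nonneg_of_mem_Icc hθ
    have h2 : 0 < deriv F (Ψ (φ, θ)) + 6 := by linarith [hF' (Ψ (φ, θ))]
    positivity) (by linarith) hφ (Set.Ioo_subset_Icc_self hθ)
  have h1 := Real.cos_pos_of_mem_Ioo hθ
  have h2 : 0 < deriv F (Ψ (φ, θ)) + 6 := by linarith [hF' (Ψ (φ, θ))]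
  have h3 : 0 < Real.cos θ ^ 3 * (deriv F (Ψ (φ, θ)) + 6) := by positivity
  exact pow_eq_zero_iff two_ne_zero |>.1 ((mul_eq_zero.1 hR0).resolve_left h3.ne')

/-- The first vector of the orthonormal frame adapted to the axis of longitude `α` and
latitude `β`, pointing east. -/
def frameEast (α : ℝ) : ℝ × ℝ × ℝ := (-Real.sin α, Real.cos α, 0)

/-- The second vector of the adapted frame, pointing north. -/
def frameNorth (α β : ℝ) : ℝ × ℝ × ℝ :=
  (-(Real.cos α * Real.sin β), -(Real.sin α * Real.sin β), Real.cos β)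

/-- The linear map sending the standard basis of `ℝ³` to `a`, `b`, `c`. -/
def frameMap (a b c : ℝ × ℝ × ℝ) : ℝ × ℝ × ℝ →L[ℝ] ℝ × ℝ × ℝ :=
  (ContinuousLinearMap.fst ℝ ℝ (ℝ × ℝ)).smulRight a
    + ((ContinuousLinearMap.fst ℝ ℝ ℝ).comp (ContinuousLinearMap.snd ℝ ℝ (ℝ × ℝ))).smulRight b
    + ((ContinuousLinearMap.snd ℝ ℝ ℝ).comp (ContinuousLinearMap.snd ℝ ℝ (ℝ × ℝ))).smulRight c

theorem frameMap_apply (a b c x : ℝ × ℝ × ℝ) :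
    frameMap a b c x = x.1 • a + x.2.1 • b + x.2.2 • c := by
  simp [frameMap]

/-- The rotation carrying the standard basis to the adapted frame. -/
def axisRotation (α β : ℝ) : ℝ × ℝ × ℝ →L[ℝ] ℝ × ℝ × ℝ :=
  frameMap (frameEast α) (frameNorth α β) (sphPt α β)

theorem axisRotation_apply (α β : ℝ) (x : ℝ × ℝ × ℝ) : axisRotation α β x =
    (x.1 * -Real.sin α - x.2.1 * (Real.cos α * Real.sin β) + x.2.2 * (Real.cos α * Real.cos β),
      x.1 * Real.cos α - x.2.1 * (Real.sin α * Real.sin β) + x.2.2 * (Real.sin α * Real.cos β),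
      x.2.1 * Real.cos β + x.2.2 * Real.sin β) := by
  ext <;> simp [axisRotation, frameMap_apply, frameEast, frameNorth, sphPt] <;> ring

/-- The Laplace–Beltrami operator of the unit sphere in terms of an extension to `ℝ³`. -/
def ambientLB (f : ℝ × ℝ × ℝ → ℝ) (x : ℝ × ℝ × ℝ) : ℝ :=
  fderiv ℝ (fderiv ℝ f) x (1, 0, 0) (1, 0, 0) + fderiv ℝ (fderiv ℝ f) x (0, 1, 0) (0, 1, 0)
    + fderiv ℝ (fderiv ℝ f) x (0, 0, 1) (0, 0, 1) - fderiv ℝ (fderiv ℝ f) x x x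
    - 2 * fderiv ℝ f x x

theorem hasDerivAt_comp_curve {f : ℝ × ℝ × ℝ → ℝ} (hf : ContDiff ℝ ∞ f)
    {c : ℝ → ℝ × ℝ × ℝ} {v : ℝ × ℝ × ℝ} {t : ℝ} (hc : HasDerivAt c v t) :
    HasDerivAt (fun s => f (c s)) (fderiv ℝ f (c t) v) t :=
  (hf.differentiable (by simp) (c t)).hasFDerivAt.comp_hasDerivAt t hc

theorem iteratedDeriv_two_comp_curve {f : ℝ × ℝ × ℝ → ℝ} (hf : ContDiff ℝ ∞ f)
    {c c' c'' : ℝ → ℝ × ℝ × ℝ} (hc : ∀ t, HasDerivAt c (c' t) t)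
    (hc' : ∀ t, HasDerivAt c' (c'' t) t) (t : ℝ) :
    iteratedDeriv 2 (fun s => f (c s)) t
      = fderiv ℝ (fderiv ℝ f) (c t) (c' t) (c' t) + fderiv ℝ f (c t) (c'' t) := by
  have h1 : deriv (fun s => f (c s)) = fun s => fderiv ℝ f (c s) (c' s) :=
    funext fun s => (hasDerivAt_comp_curve hf (hc s)).deriv
  have hd : Differentiable ℝ (fderiv ℝ f) :=
    (hf.fderiv_right (m := ∞) (by simp)).differentiable (by simp)
  rw [iteratedDeriv_succ, iteratedDeriv_one, h1]
  exact (((hd (c t)).hasFDerivAt.comp_hasDerivAt t (hc t)).clm_apply (hc' t)).deriv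

theorem LB_comp_frameMap {f : ℝ × ℝ × ℝ → ℝ} (hf : ContDiff ℝ ∞ f) (a b c : ℝ × ℝ × ℝ)
    (φ : ℝ) {θ : ℝ} (hθ : Real.cos θ ≠ 0) :
    LB (sphRep fun x => f (frameMap a b c x)) φ θ =
      (fun y => fderiv ℝ (fderiv ℝ f) y a a + fderiv ℝ (fderiv ℝ f) y b b
        + fderiv ℝ (fderiv ℝ f) y c c - fderiv ℝ (fderiv ℝ f) y y y - 2 * fderiv ℝ f y y)
        (frameMap a b c (sphPt φ θ)) := by
  set T := frameMap a b c
  have hs := fun x : ℝ => Real.hasDerivAt_sin x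
  have hc := fun x : ℝ => Real.hasDerivAt_cos x
  have hθ1 : ∀ t, HasDerivAt (fun t => T (sphPt φ t))
      (T (-(Real.cos φ * Real.sin t), -(Real.sin φ * Real.sin t), Real.cos t)) t := fun t =>
    T.hasFDerivAt.comp_hasDerivAt t
      ((((hc t).const_mul (Real.cos φ)).congr_deriv (by ring)).prodMk
        ((((hc t).const_mul (Real.sin φ)).congr_deriv (by ring)).prodMk (hs t)))
  have hθ2 : ∀ t, HasDerivAt
      (fun t => T (-(Real.cos φ * Real.sin t), -(Real.sin φ * Real.sin t), Real.cos t))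
      (T (-(Real.cos φ * Real.cos t), -(Real.sin φ * Real.cos t), -Real.sin t)) t := fun t =>
    T.hasFDerivAt.comp_hasDerivAt t
      (((hs t).const_mul (Real.cos φ)).neg.prodMk
        (((hs t).const_mul (Real.sin φ)).neg.prodMk (hc t)))
  have hφ1 : ∀ t, HasDerivAt (fun t => T (sphPt t θ))
      (T (-Real.sin t * Real.cos θ, Real.cos t * Real.cos θ, 0)) t := fun t =>
    T.hasFDerivAt.comp_hasDerivAt t
      (((hc t).mul_const (Real.cos θ)).prodMk (((hs t).mul_const (Real.cos θ)).prodMk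
          (hasDerivAt_const _ _)))
  have hφ2 : ∀ t, HasDerivAt
      (fun t => T (-Real.sin t * Real.cos θ, Real.cos t * Real.cos θ, 0))
      (T (-Real.cos t * Real.cos θ, -Real.sin t * Real.cos θ, 0)) t := fun t =>
    T.hasFDerivAt.comp_hasDerivAt t
      (((hs t).neg.mul_const (Real.cos θ)).prodMk (((hc t).mul_const (Real.cos θ)).prodMk
          (hasDerivAt_const _ _)))
  simp only [LB, sphRep]
  rw [iteratedDeriv_two_comp_curve hf hθ1 hθ2, iteratedDeriv_two_comp_curve hf hφ1 hφ2,
    (hasDerivAt_comp_curve hf (hθ1 θ)).deriv]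
  generalize fderiv ℝ (fderiv ℝ f) (T (sphPt φ θ)) = B
  generalize fderiv ℝ f (T (sphPt φ θ)) = L
  simp only [T, frameMap_apply, sphPt, map_add, map_smul, add_apply,
    smul_apply, smul_eq_mul, Real.tan_eq_sin_div_cos]
  generalize B a a = Baa, B a b = Bab, B a c = Bac, B b a = Bba, B b b = Bbb, B b c = Bbc,
    B c a = Bca, B c b = Bcb, B c c = Bcc, L a = La, L b = Lb, L c = Lc
  have h1 := Real.sin_sq_add_cos_sq φ
  have h2 := Real.sin_sq_add_cos_sq θ
  generalize Real.sin φ = s, Real.cos φ = r, Real.sin θ = S, Real.cos θ = R at *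
  field_simp
  grind

theorem ambientLB_axisRotation (f : ℝ × ℝ × ℝ → ℝ) (α β : ℝ) (y : ℝ × ℝ × ℝ) :
    fderiv ℝ (fderiv ℝ f) y (frameEast α) (frameEast α)
      + fderiv ℝ (fderiv ℝ f) y (frameNorth α β) (frameNorth α β)
      + fderiv ℝ (fderiv ℝ f) y (sphPt α β) (sphPt α β)
      - fderiv ℝ (fderiv ℝ f) y y y - 2 * fderiv ℝ f y y = ambientLB f y := by
  have hv : ∀ p q r : ℝ, ((p, q, r) : ℝ × ℝ × ℝ)
      = p • (1, 0, 0) + q • (0, 1, 0) + r • (0, 0, 1) := by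
    intro p q r; simp
  unfold ambientLB
  congr 2
  generalize fderiv ℝ (fderiv ℝ f) y = B
  rw [frameEast, frameNorth, sphPt, hv (-Real.sin α), hv (-(Real.cos α * Real.sin β)),
    hv (Real.cos α * Real.cos β)]
  simp only [map_add, map_smul, add_apply,
    smul_apply, smul_eq_mul]
  have h1 := Real.sin_sq_add_cos_sq α
  have h2 := Real.sin_sq_add_cos_sq β
  generalize B (1, 0, 0) (1, 0, 0) = Baa, B (1, 0, 0) (0, 1, 0) = Bab,
    B (1, 0, 0) (0, 0, 1) = Bac, B (0, 1, 0) (1, 0, 0) = Bba, B (0, 1, 0) (0, 1, 0) = Bbb,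
    B (0, 1, 0) (0, 0, 1) = Bbc, B (0, 0, 1) (1, 0, 0) = Bca, B (0, 0, 1) (0, 1, 0) = Bcb,
    B (0, 0, 1) (0, 0, 1) = Bcc
  generalize Real.sin α = s, Real.cos α = r, Real.sin β = S, Real.cos β = R at *
  grind

theorem exists_polar_angle (a b : ℝ) :
    ∃ t, a = √(a ^ 2 + b ^ 2) * Real.cos t ∧ b = √(a ^ 2 + b ^ 2) * Real.sin t := by
  have hn : ‖(⟨a, b⟩ : ℂ)‖ = √(a ^ 2 + b ^ 2) := by
    rw [Complex.norm_def, Complex.normSq_apply]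
    congr 1
    ring
  refine ⟨Complex.arg ⟨a, b⟩, ?_, ?_⟩
  · rw [← hn, Complex.norm_mul_cos_arg]
  · rw [← hn, Complex.norm_mul_sin_arg]

theorem exists_eq_sphPt {x : ℝ × ℝ × ℝ} (hx : x.1 ^ 2 + x.2.1 ^ 2 + x.2.2 ^ 2 = 1) :
    ∃ φ, x = sphPt φ (Real.arcsin x.2.2) := by
  obtain ⟨φ, h1, h2⟩ := exists_polar_angle x.1 x.2.1
  have hr : Real.cos (Real.arcsin x.2.2) = √(x.1 ^ 2 + x.2.1 ^ 2) := by
    rw [Real.cos_arcsin]; congr 1; linarith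
  refine ⟨φ, ?_⟩
  rw [sphPt, hr, Real.sin_arcsin (by nlinarith [sq_nonneg x.1, sq_nonneg x.2.1])
    (by nlinarith [sq_nonneg x.1, sq_nonneg x.2.1])]
  ext
  · simpa [mul_comm] using h1
  · simpa [mul_comm] using h2
  · rfl

theorem sphPt_mem_sphere (φ θ : ℝ) :
    (sphPt φ θ).1 ^ 2 + (sphPt φ θ).2.1 ^ 2 + (sphPt φ θ).2.2 ^ 2 = 1 := by
  have h1 := Real.sin_sq_add_cos_sq φ
  have h2 := Real.sin_sq_add_cos_sq θ
  simp only [sphPt]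
  linear_combination Real.cos θ ^ 2 * h1 + h2

theorem axisRotation_mem_sphere (α β : ℝ) {x : ℝ × ℝ × ℝ}
    (hx : x.1 ^ 2 + x.2.1 ^ 2 + x.2.2 ^ 2 = 1) :
    (axisRotation α β x).1 ^ 2 + (axisRotation α β x).2.1 ^ 2
      + (axisRotation α β x).2.2 ^ 2 = 1 := by
  have h1 := Real.sin_sq_add_cos_sq α
  have h2 := Real.sin_sq_add_cos_sq β
  rw [axisRotation_apply, ← hx]
  grind

theorem continuous_ambientLB {f : ℝ × ℝ × ℝ → ℝ} (hf : ContDiff ℝ ∞ f) :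
    Continuous (ambientLB f) := by
  have h1 : ContDiff ℝ ∞ (fderiv ℝ f) := hf.fderiv_right (by simp)
  have h2 : ContDiff ℝ ∞ (fderiv ℝ (fderiv ℝ f)) := h1.fderiv_right (by simp)
  have c1 := h1.continuous
  have c2 := h2.continuous
  unfold ambientLB
  fun_prop

theorem continuous_sphPt : Continuous fun z : ℝ × ℝ => sphPt z.1 z.2 := by
  unfold sphPt
  fun_prop

/-- The equation in coordinates gives the equation everywhere on the sphere, poles included. -/
theorem ambientLB_eq {ψ : ℝ × ℝ × ℝ → ℝ} {F : ℝ → ℝ} (hψ : ContDiff ℝ ∞ ψ) (hF : Continuous F)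
    (heq : ∀ φ θ : ℝ, θ ∈ Set.Ioo (-(π / 2)) (π / 2) →
      LB (sphRep ψ) φ θ = F (sphRep ψ φ θ))
    {x : ℝ × ℝ × ℝ} (hx : x.1 ^ 2 + x.2.1 ^ 2 + x.2.2 ^ 2 = 1) : ambientLB ψ x = F (ψ x) := by
  obtain ⟨φ, h⟩ := exists_eq_sphPt hx
  have hid : ∀ y, frameMap (1, 0, 0) (0, 1, 0) (0, 0, 1) y = y := fun y => by
    simp [frameMap_apply]
  have hEq : Set.EqOn (fun θ => ambientLB ψ (sphPt φ θ)) (fun θ => F (ψ (sphPt φ θ)))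
      (Set.Ioo (-(π / 2)) (π / 2)) := by
    intro θ hθ
    have h1 := LB_comp_frameMap hψ (1, 0, 0) (0, 1, 0) (0, 0, 1) φ
      (Real.cos_pos_of_mem_Ioo hθ).ne'
    simp only [hid] at h1
    exact h1.symm.trans (heq φ θ hθ)
  have cs : Continuous fun θ => sphPt φ θ := continuous_sphPt.comp (by fun_prop : Continuous
    fun θ : ℝ => (φ, θ))
  have hcl := hEq.closure ((continuous_ambientLB hψ).comp cs)
    (hF.comp (hψ.continuous.comp cs))
  rw [closure_Ioo (by linarith [Real.pi_pos])] at hcl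
  rw [h]
  exact hcl (Real.arcsin_mem_Icc _)

theorem LB_axisRotation_eq {ψ : ℝ × ℝ × ℝ → ℝ} {F : ℝ → ℝ} (hψ : ContDiff ℝ ∞ ψ)
    (hF : Continuous F)
    (heq : ∀ φ θ : ℝ, θ ∈ Set.Ioo (-(π / 2)) (π / 2) →
      LB (sphRep ψ) φ θ = F (sphRep ψ φ θ))
    (α β φ : ℝ) {θ : ℝ} (hθ : θ ∈ Set.Ioo (-(π / 2)) (π / 2)) :
    LB (sphRep fun x => ψ (axisRotation α β x)) φ θ
      = F (sphRep (fun x => ψ (axisRotation α β x)) φ θ) := by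
  have h := LB_comp_frameMap hψ (frameEast α) (frameNorth α β) (sphPt α β) φ
    (Real.cos_pos_of_mem_Ioo hθ).ne'
  simp only [ambientLB_axisRotation] at h
  exact h.trans (ambientLB_eq hψ hF heq (axisRotation_mem_sphere α β (sphPt_mem_sphere φ θ)))

theorem hasDerivAt_rectInt {h h' : ℝ × ℝ × ℝ → ℝ} (ch : Continuous h) (ch' : Continuous h')
    (hd : ∀ φ θ t, HasDerivAt (fun t => h (φ, θ, t)) (h' (φ, θ, t)) t) (b : ℝ) :
    HasDerivAt (fun t => rectInt fun z => h (z.1, z.2, t))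
      (rectInt fun z => h' (z.1, z.2, b)) b := by
  refine hasDerivAt_intervalIntegral_snd
    (f := fun w : ℝ × ℝ => ∫ φ in (0)..(2 * π), h (φ, w.1, w.2))
    (f' := fun w : ℝ × ℝ => ∫ φ in (0)..(2 * π), h' (φ, w.1, w.2))
    (continuous_intervalIntegral_fst ch _ _) (continuous_intervalIntegral_fst ch' _ _)
    (fun θ t => ?_) _ _ b
  exact hasDerivAt_intervalIntegral_snd
    (f := fun w : ℝ × ℝ => h (w.1, θ, w.2)) (f' := fun w : ℝ × ℝ => h' (w.1, θ, w.2))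
    (by fun_prop) (by fun_prop) (fun φ s => hd φ θ s) 0 (2 * π) t

/-- The surface integral in coordinates is invariant under rotations. -/
theorem rectInt_axisRotation {f : ℝ × ℝ × ℝ → ℝ} (hf : ContDiff ℝ ∞ f) (α β : ℝ) :
    rectInt (fun z => f (axisRotation α β (sphPt z.1 z.2)) * Real.cos z.2)
      = rectInt (fun z => f (sphPt z.1 z.2) * Real.cos z.2) := by
  have cf : Continuous f := hf.continuous
  have cD : Continuous (fderiv ℝ f) := (hf.fderiv_right (m := ∞) (by simp)).continuous
  have hsd := fun x : ℝ => Real.hasDerivAt_sin x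
  have hcd := fun x : ℝ => Real.hasDerivAt_cos x
  set J : ℝ → ℝ := fun β =>
    rectInt (fun z => f (axisRotation α β (sphPt z.1 z.2)) * Real.cos z.2) with hJ
  set V : ℝ → ℝ → ℝ → ℝ × ℝ × ℝ := fun φ θ β =>
    axisRotation α β (0, Real.sin θ, -(Real.sin φ * Real.cos θ)) with hV
  have hcurve : ∀ φ θ β, HasDerivAt (fun b => axisRotation α b (sphPt φ θ)) (V φ θ β) β := by
    intro φ θ β
    simp only [hV, axisRotation_apply, sphPt]
    refine HasDerivAt.prodMk ?_ (HasDerivAt.prodMk ?_ ?_)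
    · refine ((((hsd β).const_mul (Real.cos α)).const_mul (Real.sin φ * Real.cos θ)).const_sub
        (Real.cos φ * Real.cos θ * -Real.sin α) |>.add
        (((hcd β).const_mul (Real.cos α)).const_mul (Real.sin θ))).congr_deriv ?_
      ring
    · refine ((((hsd β).const_mul (Real.sin α)).const_mul (Real.sin φ * Real.cos θ)).const_sub
        (Real.cos φ * Real.cos θ * Real.cos α) |>.add
        (((hcd β).const_mul (Real.sin α)).const_mul (Real.sin θ))).congr_deriv ?_
      ring
    · refine (((hcd β).const_mul (Real.sin φ * Real.cos θ)).add
        ((hsd β).const_mul (Real.sin θ))).congr_deriv ?_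
      ring
  have cpt : Continuous fun z : ℝ × ℝ × ℝ => axisRotation α z.2.2 (sphPt z.1 z.2.1) := by
    simp only [axisRotation_apply, sphPt]
    fun_prop
  have cV : Continuous fun z : ℝ × ℝ × ℝ => V z.1 z.2.1 z.2.2 := by
    simp only [hV, axisRotation_apply]
    fun_prop
  have ch : Continuous fun z : ℝ × ℝ × ℝ =>
      f (axisRotation α z.2.2 (sphPt z.1 z.2.1)) * Real.cos z.2.1 := by fun_prop
  have ch' : Continuous fun z : ℝ × ℝ × ℝ =>
      fderiv ℝ f (axisRotation α z.2.2 (sphPt z.1 z.2.1)) (V z.1 z.2.1 z.2.2)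
        * Real.cos z.2.1 := by fun_prop
  have hJd : ∀ b, HasDerivAt J (rectInt fun z =>
      fderiv ℝ f (axisRotation α b (sphPt z.1 z.2)) (V z.1 z.2 b) * Real.cos z.2) b := by
    intro b
    exact hasDerivAt_rectInt ch ch'
      (fun φ θ t => (hasDerivAt_comp_curve hf (hcurve φ θ t)).mul_const (Real.cos θ)) b
  have hJ0 : ∀ b, rectInt (fun z =>
      fderiv ℝ f (axisRotation α b (sphPt z.1 z.2)) (V z.1 z.2 b) * Real.cos z.2) = 0 := by
    intro b
    set T := axisRotation α b
    have csph := continuous_sphPt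
    set Xθ : ℝ × ℝ → ℝ := fun z => fderiv ℝ f (T (sphPt z.1 z.2))
      (T (-(Real.cos z.1 * Real.sin z.2), -(Real.sin z.1 * Real.sin z.2), Real.cos z.2)) with hXθ
    set Xφ : ℝ × ℝ → ℝ := fun z => fderiv ℝ f (T (sphPt z.1 z.2))
      (T (-Real.sin z.1 * Real.cos z.2, Real.cos z.1 * Real.cos z.2, 0)) with hXφ
    have cXθ : Continuous Xθ :=
      (cD.comp (by fun_prop)).clm_apply (by fun_prop)
    have cXφ : Continuous Xφ :=
      (cD.comp (by fun_prop)).clm_apply (by fun_prop)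
    have hθ1 : ∀ φ t, HasDerivAt (fun t => f (T (sphPt φ t))) (Xθ (φ, t)) t := fun φ t =>
      hasDerivAt_comp_curve hf (T.hasFDerivAt.comp_hasDerivAt t
        ((((hcd t).const_mul (Real.cos φ)).congr_deriv (by ring)).prodMk
          ((((hcd t).const_mul (Real.sin φ)).congr_deriv (by ring)).prodMk (hsd t))))
    have hφ1 : ∀ t θ, HasDerivAt (fun t => f (T (sphPt t θ))) (Xφ (t, θ)) t := fun t θ =>
      hasDerivAt_comp_curve hf (T.hasFDerivAt.comp_hasDerivAt t
        (((hcd t).mul_const (Real.cos θ)).prodMk (((hsd t).mul_const (Real.cos θ)).prodMk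
          (hasDerivAt_const _ _))))
    have hA := rectInt_eq_zero_of_hasDerivAt_snd
      (g := fun z => Real.sin z.1 * (Real.cos z.2 * f (T (sphPt z.1 z.2))))
      (g' := fun z => Real.sin z.1 * (-Real.sin z.2 * f (T (sphPt z.1 z.2))
        + Real.cos z.2 * Xθ z)) (by fun_prop)
      (fun φ θ => ((hcd θ).mul (hθ1 φ θ)).const_mul (Real.sin φ)) (by simp) (by simp)
    have hB := rectInt_eq_zero_of_hasDerivAt_fst
      (g := fun z => Real.sin z.2 * (Real.cos z.1 * f (T (sphPt z.1 z.2))))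
      (g' := fun z => Real.sin z.2 * (-Real.sin z.1 * f (T (sphPt z.1 z.2))
        + Real.cos z.1 * Xφ z)) (by fun_prop)
      (fun φ θ => ((hcd φ).mul (hφ1 φ θ)).const_mul (Real.sin θ)) (fun θ => by simp [sphPt])
    have hAB : rectInt (fun z => (-1) * (Real.sin z.1 * (-Real.sin z.2 * f (T (sphPt z.1 z.2))
        + Real.cos z.2 * Xθ z)) + Real.sin z.2 * (-Real.sin z.1 * f (T (sphPt z.1 z.2))
        + Real.cos z.1 * Xφ z)) = 0 := by
      rw [rectInt_add (by fun_prop) (by fun_prop), rectInt_const_mul, hA, hB]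
      simp
    rw [← hAB]
    congr 1
    funext z
    have hvec : Real.cos z.2 • V z.1 z.2 b =
        (-(Real.sin z.1 * Real.cos z.2)) • T (-(Real.cos z.1 * Real.sin z.2),
          -(Real.sin z.1 * Real.sin z.2), Real.cos z.2)
        + (Real.sin z.2 * Real.cos z.1) • T (-Real.sin z.1 * Real.cos z.2,
          Real.cos z.1 * Real.cos z.2, 0) := by
      simp only [hV, ← map_smul, ← map_add]
      congr 1
      have h1 := Real.sin_sq_add_cos_sq z.1
      ext
      · simp; ring
      · simp; linear_combination -(Real.sin z.2 * Real.cos z.2) * h1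
      · simp; ring
    have := congrArg (fderiv ℝ f (T (sphPt z.1 z.2))) hvec
    simp only [map_smul, map_add, smul_eq_mul] at this
    simp only [hXθ, hXφ]
    linear_combination this
  have hconst : J β = J (π / 2) := is_const_of_deriv_eq_zero
    (fun b => (hJd b).differentiableAt) (fun b => by rw [(hJd b).deriv, hJ0]) _ _
  refine hconst.trans ?_
  simp only [hJ, rectInt]
  refine intervalIntegral.integral_congr fun θ _ => ?_
  have hrot : ∀ φ, axisRotation α (π / 2) (sphPt φ θ) = sphPt (φ + (α + π / 2)) θ := by
    intro φ
    rw [axisRotation_apply]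
    simp only [sphPt, ← add_assoc, Real.cos_add, Real.sin_add, Real.cos_pi_div_two,
      Real.sin_pi_div_two]
    ext <;> simp <;> ring
  simp only [hrot]
  have hper : Function.Periodic (fun φ => f (sphPt φ θ) * Real.cos θ) (2 * π) := fun φ => by
    simp [sphPt]
  rw [intervalIntegral.integral_comp_add_right (fun φ => f (sphPt φ θ) * Real.cos θ), zero_add,
    add_comm (2 * π)]
  simpa using hper.intervalIntegral_add_eq (α + π / 2) 0

theorem axisRotation_left_inverse (α β : ℝ) (x : ℝ × ℝ × ℝ) :
    (axisRotation α β x).1 * (frameEast α).1 + (axisRotation α β x).2.1 * (frameEast α).2.1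
        + (axisRotation α β x).2.2 * (frameEast α).2.2 = x.1 ∧
      (axisRotation α β x).1 * (frameNorth α β).1 + (axisRotation α β x).2.1 * (frameNorth α β).2.1
        + (axisRotation α β x).2.2 * (frameNorth α β).2.2 = x.2.1 := by
  have h1 := Real.sin_sq_add_cos_sq α
  have h2 := Real.sin_sq_add_cos_sq β
  simp only [axisRotation_apply, frameEast, frameNorth]
  constructor <;> grind

theorem axisRotation_right_inverse (α β : ℝ) (x : ℝ × ℝ × ℝ) :
    axisRotation α β (x.1 * (frameEast α).1 + x.2.1 * (frameEast α).2.1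
        + x.2.2 * (frameEast α).2.2,
      x.1 * (frameNorth α β).1 + x.2.1 * (frameNorth α β).2.1 + x.2.2 * (frameNorth α β).2.2,
      x.1 * (sphPt α β).1 + x.2.1 * (sphPt α β).2.1 + x.2.2 * (sphPt α β).2.2) = x := by
  have h1 := Real.sin_sq_add_cos_sq α
  have h2 := Real.sin_sq_add_cos_sq β
  simp only [axisRotation_apply, frameEast, frameNorth, sphPt]
  ext <;> simp only <;> grind

/-- A solution whose first spherical moments transverse to the polar axis vanish is zonal. -/
theorem sphRep_eq_of_moments {f : ℝ × ℝ × ℝ → ℝ} {F : ℝ → ℝ} (hf : ContDiff ℝ ∞ f)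
    (hF : ContDiff ℝ 1 F) (hF' : ∀ s, deriv F s > -6)
    (heq : ∀ φ θ : ℝ, θ ∈ Set.Ioo (-(π / 2)) (π / 2) → LB (sphRep f) φ θ = F (sphRep f φ θ))
    (hc : rectInt (fun z => f (sphPt z.1 z.2) * (sphPt z.1 z.2).1 * Real.cos z.2) = 0)
    (hs : rectInt (fun z => f (sphPt z.1 z.2) * (sphPt z.1 z.2).2.1 * Real.cos z.2) = 0)
    (φ : ℝ) {θ : ℝ} (hθ : θ ∈ Set.Icc (-(π / 2)) (π / 2)) : f (sphPt φ θ) = f (sphPt 0 θ) := by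
  set Ψ : ℝ × ℝ → ℝ := fun z => f (sphPt z.1 z.2) with hΨdef
  set p : ℝ × ℝ → ℝ := fun z =>
    fderiv ℝ f (sphPt z.1 z.2) (-Real.sin z.1, Real.cos z.1, 0) with hpdef
  have hsph : ContDiff ℝ ∞ fun z : ℝ × ℝ => sphPt z.1 z.2 := by unfold sphPt; fun_prop
  have hΨ : ContDiff ℝ ∞ Ψ := hf.comp hsph
  have hp : ContDiff ℝ ∞ p :=
    ((hf.fderiv_right (m := ∞) (by simp)).comp hsph).clm_apply (by fun_prop)
  have hu : ∀ z, pderivFst Ψ z = Real.cos z.2 * p z := by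
    rintro ⟨x, y⟩
    have hd := hasDerivAt_comp_curve hf (c := fun t => sphPt t y)
      (((Real.hasDerivAt_cos x).mul_const (Real.cos y)).prodMk
        (((Real.hasDerivAt_sin x).mul_const (Real.cos y)).prodMk
          (hasDerivAt_const x (Real.sin y))))
    rw [(hasDerivAt_pderivFst hΨ x y).unique hd]
    simp only [hpdef]
    rw [← smul_eq_mul (Real.cos y), ← map_smul]
    congr 1
    ext <;> simp [mul_comm]
  have hperp : ∀ φ θ, p (φ + 2 * π, θ) = p (φ, θ) := by intro φ θ; simp [hpdef, sphPt]
  have hzero : ∀ t, pderivFst Ψ (t, θ) = 0 := by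
    intro t
    rw [hu]
    rcases (Real.cos_nonneg_of_mem_Icc hθ).eq_or_lt with h | h
    · simp [← h]
    · have hθ' : θ ∈ Set.Ioo (-(π / 2)) (π / 2) := by
        refine ⟨lt_of_le_of_ne hθ.1 ?_, lt_of_le_of_ne hθ.2 ?_⟩
        · rintro rfl; simp at h
        · rintro rfl; simp at h
      obtain ⟨s, hs', hst⟩ := Function.Periodic.exists_mem_Ico₀ (f := fun t => p (t, θ))
        (fun t => hperp t θ) (by positivity : 0 < 2 * π) t
      rw [show p (t, θ) = p (s, θ) from hst,
        longitude_independent hΨ hp hF hF' (by intro φ θ; simp [hΨdef, sphPt]) hperp hu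
        ?_ (by simpa [hΨdef, sphPt] using hc) (by simpa [hΨdef, sphPt] using hs)
        (Set.Ico_subset_Icc_self hs') hθ', mul_zero]
      intro φ θ hθ
      have h := heq φ θ hθ
      have hne := (Real.cos_pos_of_mem_Ioo hθ).ne'
      have e1 : deriv (fun t => Ψ (φ, t)) = fun t => pderivSnd Ψ (φ, t) :=
        funext fun t => (hasDerivAt_pderivSnd hΨ φ t).deriv
      have e2 : deriv (fun t => Ψ (t, θ)) = fun t => pderivFst Ψ (t, θ) :=
        funext fun t => (hasDerivAt_pderivFst hΨ t θ).deriv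
      have e3 : deriv (fun t => pderivFst Ψ (t, θ)) φ = Real.cos θ * pderivFst p (φ, θ) := by
        simp only [hu]
        exact ((hasDerivAt_pderivFst hp φ θ).const_mul (Real.cos θ)).deriv
      change iteratedDeriv 2 (fun t => Ψ (φ, t)) θ - Real.tan θ * deriv (fun t => Ψ (φ, t)) θ
        + 1 / Real.cos θ ^ 2 * iteratedDeriv 2 (fun t => Ψ (t, θ)) φ = F (Ψ (φ, θ)) at h
      rw [iteratedDeriv_succ, iteratedDeriv_one, iteratedDeriv_succ, iteratedDeriv_one, e1, e2, e3,
        (hasDerivAt_pderivSnd hΨ.pderivSnd φ θ).deriv, Real.tan_eq_sin_div_cos] at h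
      rw [← h]
      field_simp
  exact is_const_of_deriv_eq_zero (f := fun t => Ψ (t, θ))
    (fun t => (hasDerivAt_pderivFst hΨ t θ).differentiableAt)
    (fun t => by rw [(hasDerivAt_pderivFst hΨ t θ).deriv, hzero]) φ 0

/-- If `F' > −6` everywhere and the spherical representation of the smooth function `ψ`
satisfies `ΔΨ = F(Ψ)`, then `ψ` is zonal up to a rotation: on the unit sphere,
`ψ x = g (⟨x, v⟩)` for some unit vector `v` and some `g : ℝ → ℝ`. -/
theorem rigidity_zonal_up_to_rotation (ψ : ℝ × ℝ × ℝ → ℝ) (F : ℝ → ℝ)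
    (hψ : ContDiff ℝ (⊤ : ℕ∞) ψ) (hF : ContDiff ℝ 1 F)
    (hF' : ∀ s : ℝ, deriv F s > -6)
    (heq : ∀ φ θ : ℝ, θ ∈ Set.Ioo (-(π/2)) (π/2) →
      LB (sphRep ψ) φ θ = F (sphRep ψ φ θ)) :
    ∃ v : ℝ × ℝ × ℝ, v.1 ^ 2 + v.2.1 ^ 2 + v.2.2 ^ 2 = 1 ∧
      ∃ g : ℝ → ℝ, ∀ x : ℝ × ℝ × ℝ, x.1 ^ 2 + x.2.1 ^ 2 + x.2.2 ^ 2 = 1 →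
        ψ x = g (x.1 * v.1 + x.2.1 * v.2.1 + x.2.2 * v.2.2) := by
  have hcont : Continuous fun z : ℝ × ℝ => ψ (sphPt z.1 z.2) :=
    hψ.continuous.comp continuous_sphPt
  have csph := continuous_sphPt
  set m₁ := rectInt (fun z => ψ (sphPt z.1 z.2) * (sphPt z.1 z.2).1 * Real.cos z.2) with hm₁
  set m₂ := rectInt (fun z => ψ (sphPt z.1 z.2) * (sphPt z.1 z.2).2.1 * Real.cos z.2) with hm₂
  set m₃ := rectInt (fun z => ψ (sphPt z.1 z.2) * (sphPt z.1 z.2).2.2 * Real.cos z.2) with hm₃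
  have hlin : ∀ a b c : ℝ, rectInt (fun z => ψ (sphPt z.1 z.2) * ((sphPt z.1 z.2).1 * a
      + (sphPt z.1 z.2).2.1 * b + (sphPt z.1 z.2).2.2 * c) * Real.cos z.2)
      = a * m₁ + b * m₂ + c * m₃ := by
    intro a b c
    rw [hm₁, hm₂, hm₃, ← rectInt_const_mul, ← rectInt_const_mul, ← rectInt_const_mul,
      ← rectInt_add (by fun_prop) (by fun_prop), ← rectInt_add (by fun_prop) (by fun_prop)]
    congr 1
    funext z
    ring
  obtain ⟨α, hα₁, hα₂⟩ := exists_polar_angle m₁ m₂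
  obtain ⟨β, hβ₁, hβ₂⟩ := exists_polar_angle (√(m₁ ^ 2 + m₂ ^ 2)) m₃
  set ρ := √(m₁ ^ 2 + m₂ ^ 2)
  set r := √(ρ ^ 2 + m₃ ^ 2)
  have hrot : ∀ e : ℝ × ℝ × ℝ, e.1 * m₁ + e.2.1 * m₂ + e.2.2 * m₃ = 0 →
      rectInt (fun z => ψ (axisRotation α β (sphPt z.1 z.2))
        * ((axisRotation α β (sphPt z.1 z.2)).1 * e.1 + (axisRotation α β (sphPt z.1 z.2)).2.1 * e.2.1
          + (axisRotation α β (sphPt z.1 z.2)).2.2 * e.2.2) * Real.cos z.2) = 0 := by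
    intro e he
    have h := rectInt_axisRotation (f := fun x => ψ x * (x.1 * e.1 + x.2.1 * e.2.1 + x.2.2 * e.2.2))
      (by fun_prop) α β
    rw [h, hlin, he]
  have hc := hrot (frameEast α) (by
    simp only [frameEast]
    linear_combination (-Real.sin α) * hα₁ + Real.cos α * hα₂)
  have hs := hrot (frameNorth α β) (by
    have h1 := Real.sin_sq_add_cos_sq α
    simp only [frameNorth]
    linear_combination (-(Real.cos α * Real.sin β)) * hα₁ - Real.sin α * Real.sin β * hα₂
      - ρ * Real.sin β * h1 - Real.sin β * hβ₁ + Real.cos β * hβ₂)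
  simp only [(axisRotation_left_inverse α β _).1] at hc
  simp only [(axisRotation_left_inverse α β _).2] at hs
  have hzonal := fun φ θ hθ => sphRep_eq_of_moments (f := fun x => ψ (axisRotation α β x))
    (hψ.comp (axisRotation α β).contDiff) hF hF'
    (fun φ θ hθ => LB_axisRotation_eq hψ hF.continuous heq α β φ hθ) hc hs φ (θ := θ) hθ
  refine ⟨sphPt α β, sphPt_mem_sphere α β,
    fun s => ψ (axisRotation α β (sphPt 0 (Real.arcsin s))), fun x hx => ?_⟩
  have hinv := axisRotation_right_inverse α β x
  set y : ℝ × ℝ × ℝ := (x.1 * (frameEast α).1 + x.2.1 * (frameEast α).2.1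
      + x.2.2 * (frameEast α).2.2,
    x.1 * (frameNorth α β).1 + x.2.1 * (frameNorth α β).2.1 + x.2.2 * (frameNorth α β).2.2,
    x.1 * (sphPt α β).1 + x.2.1 * (sphPt α β).2.1 + x.2.2 * (sphPt α β).2.2) with hy
  have hysph : y.1 ^ 2 + y.2.1 ^ 2 + y.2.2 ^ 2 = 1 := by
    have h1 := Real.sin_sq_add_cos_sq α
    have h2 := Real.sin_sq_add_cos_sq β
    rw [← hx]
    simp only [hy, frameEast, frameNorth, sphPt]
    grind
  obtain ⟨φ, hφ⟩ := exists_eq_sphPt hysph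
  have h := hzonal φ _ (Real.arcsin_mem_Icc y.2.2)
  rw [← hφ, hinv] at h
  exact h
end
end
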